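/- Let p be a prime, V = (F_p)^3 the natural 3-dimensional vector space over the prime field F_p, and G a finite subgroup of SL(3, F_p) = SL(V). If V is a reducible G-module (i.e., V possesses a G-stable subspace different from 0 and V), then the invariant ring S(V)^G is a Gorenstein ring. -/

import Mathlib

noncomputable section
open CategoryTheory Matrix MvPolynomial

universe u

/-- A module `M` over `R` has finite injective dimension iff the Ext functors
`Ext^i(-, M)` vanish for all sufficiently large `i`. -/
def HasFiniteInjectiveDimension (R : Type u) [CommRing R] (M : ModuleCat.{u} R) : Prop :=
  ∃ n : ℕ, ∀ (N : ModuleCat.{u} R) (i : ℕ), n < i →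
    Subsingleton (((Ext R (ModuleCat.{u} R) i).obj (Opposite.op N)).obj M)

/-- A commutative ring is Gorenstein if it is Noetherian and its localization at every
prime ideal has finite injective dimension over itself. -/
def IsGorensteinRing (R : Type u) [CommRing R] : Prop :=
  IsNoetherianRing R ∧ ∀ (P : Ideal R) [P.IsPrime],
    HasFiniteInjectiveDimension (Localization.AtPrime P)
      (ModuleCat.of (Localization.AtPrime P) (Localization.AtPrime P))

/-- The substitution action of a matrix on polynomials: `X i ↦ ∑ j, M i j • X j`. -/
def polyAct {F : Type u} [CommSemiring F] {m : ℕ} (M : Matrix (Fin m) (Fin m) F) :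
    MvPolynomial (Fin m) F →ₐ[F] MvPolynomial (Fin m) F :=
  MvPolynomial.aeval fun i => ∑ j, M i j • MvPolynomial.X j

/-- The subalgebra of polynomials invariant under a set of matrices. -/
def invariantAlg {F : Type u} [CommSemiring F] {m : ℕ} (S : Set (Matrix (Fin m) (Fin m) F)) :
    Subalgebra F (MvPolynomial (Fin m) F) where
  carrier := {f | ∀ M ∈ S, polyAct M f = f}
  mul_mem' := fun hf hg => fun M hM => by rw [_root_.map_mul, hf M hM, hg M hM]
  add_mem' := fun hf hg => fun M hM => by rw [_root_.map_add, hf M hM, hg M hM]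
  algebraMap_mem' := fun r => fun M hM => (polyAct M).commutes r

/-- The invariant ring `S(V)^G` for a subgroup `G` of `SL(m, F)`, where `S(V)` is realised
as the polynomial ring `F[X 0, …, X (m-1)]`. -/
def invariantRing {F : Type u} [Field F] {m : ℕ}
    (G : Subgroup (Matrix.SpecialLinearGroup (Fin m) F)) :
    Subalgebra F (MvPolynomial (Fin m) F) :=
  invariantAlg {M | ∃ g ∈ G, (g : Matrix (Fin m) (Fin m) F) = M}

/-- A matrix `M` is a transvection if `rank (M - 1) = 1` and `(M - 1)² = 0`. -/
def IsTransvectionMat {F : Type u} [Field F] {m : ℕ} (M : Matrix (Fin m) (Fin m) F) : Prop :=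
  (M - 1).rank = 1 ∧ (M - 1) * (M - 1) = 0

/-- `T(G)`: the subgroup generated by all transvections contained in `G`. -/
def transSubgroup {F : Type u} [Field F] {m : ℕ}
    (G : Subgroup (Matrix.SpecialLinearGroup (Fin m) F)) :
    Subgroup (Matrix.SpecialLinearGroup (Fin m) F) :=
  Subgroup.closure {g | g ∈ G ∧ IsTransvectionMat (g : Matrix (Fin m) (Fin m) F)}

/-- Dimension shifting: a cocycle with values in a module of injective dimension at most `n` is a
coboundary in degrees above `n`. -/
lemma ModuleCat.exists_d_comp_eq_of_hasInjectiveDimensionLE {R : Type u} [CommRing R] (n : ℕ) :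
    ∀ (M : ModuleCat.{u} R) [HasInjectiveDimensionLE M n] {N : ModuleCat.{u} R}
      (P : ProjectiveResolution N) (i : ℕ) (_ : n ≤ i) (f : P.complex.X (i + 1) ⟶ M)
      (_ : P.complex.d (i + 2) (i + 1) ≫ f = 0),
      ∃ g : P.complex.X i ⟶ M, P.complex.d (i + 1) i ≫ g = f := by
  induction n with
  | zero =>
    intro M hM N P i _ f hf
    have : Injective M := injective_iff_hasInjectiveDimensionLT_one.mpr hM
    exact ⟨(P.exact_succ i).descToInjective f hf, (P.exact_succ i).comp_descToInjective f hf⟩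
  | succ n ih =>
    intro M hM N P i hi f hf
    obtain ⟨j, rfl⟩ : ∃ j, i = j + 1 := ⟨i - 1, by omega⟩
    have ei : EnoughInjectives (ModuleCat.{u} R) := inferInstance
    obtain ⟨I, inj, ι, monoι⟩ := ei.1 M
    let T := ShortComplex.mk ι (Limits.cokernel.π ι) (Limits.cokernel.condition ι)
    have T_exact : T.ShortExact := { exact := ShortComplex.exact_cokernel ι }
    have hT3 : HasInjectiveDimensionLE T.X₃ n :=
      (T_exact.hasInjectiveDimensionLT_X₃_iff n ‹_›).mpr ‹_›
    have hfι : P.complex.d (j + 1 + 2) (j + 1 + 1) ≫ f ≫ ι = 0 := by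
      rw [← Category.assoc, hf, Limits.zero_comp]
    obtain ⟨g, hg⟩ : ∃ g : P.complex.X (j + 1) ⟶ I, P.complex.d (j + 2) (j + 1) ≫ g = f ≫ ι :=
      ⟨(P.exact_succ (j + 1)).descToInjective (f ≫ ι) hfι,
        (P.exact_succ (j + 1)).comp_descToInjective (f ≫ ι) hfι⟩
    obtain ⟨h, hh⟩ := ih T.X₃ P j (by omega) (g ≫ T.g) (by
      rw [← Category.assoc, hg, Category.assoc, T.zero, Limits.comp_zero])
    have : Epi T.g := T_exact.epi_g
    let h' : P.complex.X j ⟶ I := Projective.factorThru h T.g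
    have hh' : h' ≫ T.g = h := Projective.factorThru_comp _ _
    have hk : (g - P.complex.d (j + 1) j ≫ h') ≫ T.g = 0 := by
      rw [Preadditive.sub_comp, Category.assoc, hh', hh, sub_self]
    have : Mono T.f := monoι
    refine ⟨T_exact.exact.lift _ hk, ?_⟩
    rw [← cancel_mono ι, Category.assoc]
    have := T_exact.exact.lift_f _ hk
    change _ ≫ (T_exact.exact.lift _ hk ≫ T.f) = _
    rw [this, Preadditive.comp_sub, hg, ← Category.assoc, P.complex.d_comp_d, Limits.zero_comp,
      sub_zero]

lemma HasFiniteInjectiveDimension.of_hasInjectiveDimensionLE {R : Type u} [CommRing R] (n : ℕ)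
    (M : ModuleCat.{u} R) [HasInjectiveDimensionLE M n] : HasFiniteInjectiveDimension R M := by
  refine ⟨n, fun N i hi => ?_⟩
  obtain ⟨j, rfl⟩ : ∃ j, i = j + 1 := ⟨i - 1, by omega⟩
  let P : ProjectiveResolution N := projectiveResolution N
  suffices h : Limits.IsZero ((P.complex.linearYonedaObj R M).homology (j + 1)) by
    have := h.of_iso (P.isoExt (R := R) (j + 1) M)
    exact ModuleCat.subsingleton_of_isZero this
  rw [← HomologicalComplex.exactAt_iff_isZero_homology,
    HomologicalComplex.exactAt_iff' _ j (j + 1) (j + 2) (by simp) (by simp),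
    ShortComplex.moduleCat_exact_iff]
  intro f hf
  obtain ⟨g, hg⟩ := ModuleCat.exists_d_comp_eq_of_hasInjectiveDimensionLE n M P j (by omega) f hf
  exact ⟨g, hg⟩

section Coextension

variable {A R : Type u} [CommRing A] [CommRing R] [Algebra A R] [Module.Projective A R]

lemma coextendScalars_preservesEpimorphisms :
    (ModuleCat.coextendScalars.{u, u, u} (algebraMap A R)).PreservesEpimorphisms where
  preserves {M N} f hf := by
    rw [ModuleCat.epi_iff_surjective] at hf ⊢
    intro y
    let Y : (ModuleCat.restrictScalars (algebraMap A R)).obj (ModuleCat.of R R) →ₗ[A] N :=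
      ModuleCat.CoextendScalars.equiv _ _ y
    let e : R ≃ₗ[A] (ModuleCat.restrictScalars (algebraMap A R)).obj (ModuleCat.of R R) :=
      { AddEquiv.refl R with
        map_smul' := fun a r => by
          change a • r = _
          rw [Algebra.smul_def]; rfl }
    obtain ⟨g, hg⟩ := Module.projective_lifting_property f.hom (Y ∘ₗ e.toLinearMap) hf
    refine ⟨(ModuleCat.CoextendScalars.equiv (algebraMap A R) M).symm (g ∘ₗ e.symm.toLinearMap), ?_⟩
    apply ModuleCat.CoextendScalars.ext
    refine LinearMap.ext fun r => ?_
    exact LinearMap.congr_fun hg (e.symm r)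

lemma hasInjectiveDimensionLE_coextendScalars (n : ℕ) (M : ModuleCat.{u} A)
    [HasInjectiveDimensionLE M n] :
    HasInjectiveDimensionLE ((ModuleCat.coextendScalars.{u, u, u} (algebraMap A R)).obj M) n := by
  let F := ModuleCat.coextendScalars.{u, u, u} (algebraMap A R)
  have := coextendScalars_preservesEpimorphisms (A := A) (R := R)
  have adj := ModuleCat.restrictCoextendScalarsAdj.{u, u, u} (algebraMap A R)
  have := adj.right_adjoint_additive
  have := adj.rightAdjoint_preservesLimits.{0, 0}
  have : F.PreservesHomology := Functor.preservesHomology_of_preservesEpis_and_kernels F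
  induction n generalizing M with
  | zero =>
    have : Injective M := injective_iff_hasInjectiveDimensionLT_one.mpr ‹_›
    exact injective_iff_hasInjectiveDimensionLT_one.mp (adj.map_injective M this)
  | succ n ih =>
    have ei : EnoughInjectives (ModuleCat.{u} A) := inferInstance
    obtain ⟨I, inj, ι, monoι⟩ := ei.1 M
    let T := ShortComplex.mk ι (Limits.cokernel.π ι) (Limits.cokernel.condition ι)
    have hT : T.ShortExact := { exact := ShortComplex.exact_cokernel ι }
    have hT3 : HasInjectiveDimensionLE T.X₃ n := (hT.hasInjectiveDimensionLT_X₃_iff n ‹_›).mpr ‹_›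
    have := hT.mono_f
    have := hT.epi_g
    have : Mono (F.map T.f) := inferInstance
    have : Epi (F.map T.g) := inferInstance
    have hTF : (T.map F).ShortExact := hT.map F
    have : Injective (T.map F).X₂ := adj.map_injective I inj
    exact (hTF.hasInjectiveDimensionLT_X₃_iff n ‹_›).mp (ih T.X₃)

/-- If `R` is a projective `A`-module and `Hom_A(R, A)` is free of rank one over `R`, then the
self-injective dimension of `A` bounds that of `R`. -/
lemma hasInjectiveDimensionLE_of_dual (n : ℕ) [HasInjectiveDimensionLE (ModuleCat.of A A) n]
    (β : R →ₗ[A] A) (hinj : ∀ r, (∀ r', β (r * r') = 0) → r = 0)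
    (hsurj : ∀ ψ : R →ₗ[A] A, ∃ r, ∀ r', ψ r' = β (r * r')) :
    HasInjectiveDimensionLE (ModuleCat.of R R) n := by
  let C := (ModuleCat.coextendScalars.{u, u, u} (algebraMap A R)).obj (ModuleCat.of A A)
  have hC : HasInjectiveDimensionLE C n := hasInjectiveDimensionLE_coextendScalars n _
  let e : R ≃ₗ[A] (ModuleCat.restrictScalars (algebraMap A R)).obj (ModuleCat.of R R) :=
    { AddEquiv.refl R with
      map_smul' := fun a r => by
        change a • r = _
        rw [Algebra.smul_def]; rfl }
  let b : C := (ModuleCat.CoextendScalars.equiv (algebraMap A R) (ModuleCat.of A A)).symm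
    (β ∘ₗ e.symm.toLinearMap)
  have hb (r : R) : (b : R → A) r = β r := rfl
  let φ : R →ₗ[R] C := LinearMap.toSpanSingleton R C b
  have hφ (r r' : R) : (φ r : R → A) r' = β (r * r') := by
    change ((r • b : C) : R → A) r' = _
    rw [ModuleCat.CoextendScalars.smul_apply, hb, mul_comm]
  have hbij : Function.Bijective φ := by
    constructor
    · rw [injective_iff_map_eq_zero]
      intro r hr
      refine hinj r fun r' => ?_
      rw [← hφ, hr]; rfl
    · intro c
      obtain ⟨r, hr⟩ := hsurj
        ((ModuleCat.CoextendScalars.equiv (algebraMap A R) (ModuleCat.of A A) c) ∘ₗ e.toLinearMap)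
      refine ⟨r, ?_⟩
      apply ModuleCat.CoextendScalars.ext
      refine LinearMap.ext fun r' => ?_
      exact (hφ r r').trans (hr r').symm
  exact hasInjectiveDimensionLT_of_iso (LinearEquiv.ofBijective φ hbij).toModuleIso.symm _

end Coextension

lemma hasProjectiveDimensionLE_extendScalars {D E : Type u} [CommRing D] [CommRing E] {f : D →+* E}
    (hf : f.Flat) (n : ℕ) (M : ModuleCat.{u} D) [HasProjectiveDimensionLE M n] :
    HasProjectiveDimensionLE ((ModuleCat.extendScalars.{u, u, u} f).obj M) n := by
  let F := ModuleCat.extendScalars.{u, u, u} f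
  have := ModuleCat.preservesFiniteLimits_extendScalars_of_flat hf
  have adj := ModuleCat.extendRestrictScalarsAdj.{u, u, u} f
  have := adj.left_adjoint_additive
  have := adj.leftAdjoint_preservesColimits.{0, 0}
  induction n generalizing M with
  | zero =>
    have : Projective M := projective_iff_hasProjectiveDimensionLT_one.mpr ‹_›
    exact projective_iff_hasProjectiveDimensionLT_one.mp (adj.map_projective M this)
  | succ n ih =>
    let T := M.projectiveShortComplex
    have hT := M.shortExact_projectiveShortComplex
    have hT1 : HasProjectiveDimensionLE T.X₁ n :=
      (hT.hasProjectiveDimensionLT_X₃_iff n inferInstance).mp ‹_›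
    have hTF : (T.map F).ShortExact := hT.map_of_exact F
    have : Projective T.X₂ := inferInstance
    have : Projective (T.map F).X₂ := adj.map_projective _ this
    exact (hTF.hasProjectiveDimensionLT_X₃_iff n ‹_›).mpr (ih T.X₁)

section PolynomialExtension

open scoped TensorProduct

lemma tensor_induction_X_pow {D M : Type*} [CommRing D] [AddCommGroup M] [Module D M]
    {P : Polynomial D ⊗[D] M → Prop}
    (hadd : ∀ s t, P s → P t → P (s + t))
    (hX : ∀ (k : ℕ) (m : M), P ((Polynomial.X ^ k : Polynomial D) ⊗ₜ m))
    (t : Polynomial D ⊗[D] M) : P t := by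
  induction t using TensorProduct.induction_on with
  | zero => simpa using hX 0 0
  | add s t hs ht => exact hadd s t hs ht
  | tmul q m =>
    induction q using Polynomial.induction_on' with
    | add q r hq hr => rw [TensorProduct.add_tmul]; exact hadd _ _ hq hr
    | monomial k a =>
      rw [← Polynomial.C_mul_X_pow_eq_monomial, ← Polynomial.smul_eq_C_mul,
        TensorProduct.smul_tmul]
      exact hX k _

variable {D M : Type*} [CommRing D] [AddCommGroup M] [Module D M] [Module (Polynomial D) M]
  [IsScalarTower D (Polynomial D) M]

/-- Multiplication by `X ⊗ 1 - 1 ⊗ X` on `D[X] ⊗ M`. -/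
def tensorXSub (D M : Type*) [CommRing D] [AddCommGroup M] [Module D M] [Module (Polynomial D) M]
    [IsScalarTower D (Polynomial D) M] :
    Polynomial D ⊗[D] M →ₗ[Polynomial D] Polynomial D ⊗[D] M :=
  (Polynomial.X : Polynomial D) • LinearMap.id -
    LinearMap.baseChange (Polynomial D) (Algebra.lsmul D D M (Polynomial.X : Polynomial D))

lemma tensorXSub_tmul (q : Polynomial D) (m : M) : tensorXSub D M (q ⊗ₜ m) =
    (Polynomial.X * q) ⊗ₜ m - q ⊗ₜ ((Polynomial.X : Polynomial D) • m) := by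
  simp [tensorXSub, TensorProduct.smul_tmul']

/-- The contracting homotopy `X ^ k ⊗ m ↦ ∑ i < k, X ^ i ⊗ X ^ (k - 1 - i) m`. -/
def tensorHomotopy (D M : Type*) [CommRing D] [AddCommGroup M] [Module D M]
    [Module (Polynomial D) M] [IsScalarTower D (Polynomial D) M] :
    Polynomial D ⊗[D] M →ₗ[D] Polynomial D ⊗[D] M :=
  TensorProduct.lift ((Polynomial.basisMonomials D).constr D fun k =>
    ∑ i ∈ Finset.range k, TensorProduct.mk D (Polynomial D) M (Polynomial.X ^ i) ∘ₗ
      Algebra.lsmul D D M (Polynomial.X ^ (k - 1 - i) : Polynomial D))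

lemma tensorHomotopy_tmul (k : ℕ) (m : M) :
    tensorHomotopy D M ((Polynomial.X ^ k : Polynomial D) ⊗ₜ m) =
      ∑ i ∈ Finset.range k, (Polynomial.X ^ i : Polynomial D) ⊗ₜ[D]
        ((Polynomial.X ^ (k - 1 - i) : Polynomial D) • m) := by
  have : (Polynomial.X ^ k : Polynomial D) = Polynomial.basisMonomials D k := by
    simp [Polynomial.X_pow_eq_monomial]
  rw [this, tensorHomotopy, TensorProduct.lift.tmul, Module.Basis.constr_basis,
    LinearMap.sum_apply]
  rfl

lemma tensorHomotopy_tensorXSub (t : Polynomial D ⊗[D] M) :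
    tensorHomotopy D M (tensorXSub D M t) = t := by
  induction t using tensor_induction_X_pow with
  | hadd s t hs ht => simp only [map_add, hs, ht]
  | hX k m =>
    rw [tensorXSub_tmul, map_sub, ← pow_succ', tensorHomotopy_tmul, tensorHomotopy_tmul,
      Finset.sum_range_succ, add_sub_right_comm, ← Finset.sum_sub_distrib, Finset.sum_eq_zero]
    · simp
    · intro i hi
      rw [Finset.mem_range] at hi
      rw [smul_smul, ← pow_succ, sub_eq_zero]
      congr 3
      omega

lemma exists_tensorXSub_eq (t : Polynomial D ⊗[D] M) :
    ∃ u, t - 1 ⊗ₜ LinearMap.liftBaseChange (Polynomial D) (LinearMap.id : M →ₗ[D] M) t =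
      tensorXSub D M u := by
  induction t using tensor_induction_X_pow with
  | hadd s t hs ht =>
    obtain ⟨u, hu⟩ := hs
    obtain ⟨v, hv⟩ := ht
    exact ⟨u + v, by rw [map_add, map_add, TensorProduct.tmul_add, ← hu, ← hv]; abel⟩
  | hX k m =>
    induction k generalizing m with
    | zero => exact ⟨0, by simp⟩
    | succ k ih =>
      obtain ⟨u, hu⟩ := ih ((Polynomial.X : Polynomial D) • m)
      refine ⟨u + (Polynomial.X ^ k : Polynomial D) ⊗ₜ m, ?_⟩
      rw [map_add, ← hu, tensorXSub_tmul, pow_succ']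
      simp only [LinearMap.liftBaseChange_tmul, LinearMap.id_apply, smul_smul]
      rw [mul_comm Polynomial.X (Polynomial.X ^ k)]
      abel

end PolynomialExtension

/-- Hilbert's syzygy theorem, inductive step. -/
lemma hasProjectiveDimensionLE_polynomial {D : Type u} [CommRing D] (n : ℕ)
    (h : ∀ M : ModuleCat.{u} D, HasProjectiveDimensionLE M n) (M : ModuleCat.{u} (Polynomial D)) :
    HasProjectiveDimensionLE M (n + 1) := by
  let _ : Module D M := Module.compHom M (Polynomial.C : D →+* Polynomial D)
  have : IsScalarTower D (Polynomial D) M := ⟨fun a q m => by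
    rw [Polynomial.smul_eq_C_mul, mul_smul]; rfl⟩
  let T := ModuleCat.of (Polynomial D) (TensorProduct D (Polynomial D) M)
  have hT : HasProjectiveDimensionLE T n := by
    have := h (ModuleCat.of D M)
    have hf : (algebraMap D (Polynomial D)).Flat := by
      rw [RingHom.flat_algebraMap_iff]; infer_instance
    have := hasProjectiveDimensionLE_extendScalars hf n (ModuleCat.of D M)
    let E :=
      (ModuleCat.extendScalars.{u, u, u} (algebraMap D (Polynomial D))).obj (ModuleCat.of D M)
    let e₀ : (ModuleCat.restrictScalars (algebraMap D (Polynomial D))).obj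
        (ModuleCat.of (Polynomial D) (Polynomial D)) ≃ₗ[D] Polynomial D :=
      { AddEquiv.refl (Polynomial D) with
        map_smul' := fun a q => (Algebra.smul_def (A := Polynomial D) a q).symm }
    let e₁ := TensorProduct.congr e₀ (LinearEquiv.refl D M)
    let e : E ≃ₗ[Polynomial D] T :=
      { toFun := e₁
        invFun := e₁.symm
        left_inv := e₁.left_inv
        right_inv := e₁.right_inv
        map_add' := e₁.map_add
        map_smul' := fun q t => by
          refine TensorProduct.induction_on (motive := fun t =>
            e₁ ((fun x : E => q • x) t) = (fun x : T => q • x) (e₁ t)) t ?_ (fun r m => rfl)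
            (fun s t hs ht => ?_)
          · exact (congrArg e₁ (smul_zero (A := E) q)).trans (e₁.map_zero.trans
              ((congrArg (q • ·) e₁.map_zero).trans (smul_zero (A := T) q)).symm)
          · exact (congrArg e₁ (smul_add (A := E) q s t)).trans ((e₁.map_add _ _).trans
              ((congrArg₂ (fun a b : T => a + b) hs ht).trans
              ((smul_add q (e₁ s : T) (e₁ t)).symm.trans
                (congrArg (fun a : T => q • a) (e₁.map_add s t).symm)))) }
    exact hasProjectiveDimensionLT_of_iso e.toModuleIso _
  let f := tensorXSub D M
  let g := LinearMap.liftBaseChange (Polynomial D) (LinearMap.id : M →ₗ[D] M)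
  have hfg : g ∘ₗ f = 0 := by
    refine LinearMap.ext fun t => ?_
    induction t using tensor_induction_X_pow with
    | hadd s t hs ht => rw [map_add, hs, ht, map_add]
    | hX k m =>
      simp only [f, g, LinearMap.comp_apply, tensorXSub_tmul, map_sub,
        LinearMap.liftBaseChange_tmul, LinearMap.id_apply, smul_smul]
      rw [mul_comm, sub_self]; rfl
  let S : ShortComplex (ModuleCat.{u} (Polynomial D)) := ShortComplex.mk (X₁ := T) (X₂ := T)
    (X₃ := M) (ModuleCat.ofHom f) (ModuleCat.ofHom g) (by
      rw [← ModuleCat.ofHom_comp, hfg]; rfl)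
  have hS : S.ShortExact := by
    refine ShortComplex.ShortExact.mk' ?_ ?_ ?_
    · rw [ShortComplex.moduleCat_exact_iff]
      intro t ht
      obtain ⟨u, hu⟩ := exists_tensorXSub_eq t
      refine ⟨u, ?_⟩
      change g t = 0 at ht
      change tensorXSub D M u = t
      rw [← hu]
      change t - 1 ⊗ₜ g t = t
      rw [ht, TensorProduct.tmul_zero, sub_zero]
    · rw [ModuleCat.mono_iff_injective]
      exact Function.LeftInverse.injective (g := tensorHomotopy D M) tensorHomotopy_tensorXSub
    · rw [ModuleCat.epi_iff_surjective]
      intro m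
      exact ⟨(1 : Polynomial D) ⊗ₜ m, by
        change g _ = m
        simp [g]⟩
  exact hS.hasProjectiveDimensionLT_X₃ (n + 1) hT
    (hasProjectiveDimensionLT_of_ge T _ _ (Nat.le_succ _))

lemma dvd_of_forall_prime_exists {A : Type*} [CommRing A] [IsDomain A]
    [UniqueFactorizationMonoid A] (a : A) (ha : a ≠ 0) :
    ∀ b : A, (∀ q : A, Prime q → ∃ a' b' : A, a * b' = a' * b ∧ ¬ q ∣ a') → a ∣ b := by
  induction a using UniqueFactorizationMonoid.induction_on_prime with
  | h₁ => exact absurd rfl ha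
  | h₂ x hx => exact fun b _ => hx.dvd
  | h₃ a q ha0 hq ih =>
    intro b hb
    obtain ⟨a', b', h, hqa⟩ := hb q hq
    obtain ⟨c, rfl⟩ : q ∣ b := ((hq.dvd_or_dvd
      (h ▸ (dvd_mul_right q a).mul_right b' : q ∣ a' * b)).resolve_left hqa)
    refine mul_dvd_mul_left q (ih ha0 c fun π hπ => ?_)
    obtain ⟨a'', b'', h', hπ'⟩ := hb π hπ
    refine ⟨a'', b'', mul_left_cancel₀ hq.ne_zero ?_, hπ'⟩
    linear_combination h'

section QuasiGorenstein

variable {A S G : Type u} [CommRing A] [CommRing S] [Algebra A S] [Group G]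
  [MulSemiringAction G S]

lemma smul_sum_smul [Fintype G] (g : G) (s : S) : g • ∑ h : G, h • s = ∑ h : G, h • s := by
  rw [Finset.smul_sum]
  exact Fintype.sum_bijective (g * ·) (Group.mulLeft_bijective g) _ _ fun h => (mul_smul g h s).symm

lemma map_sum_smul_mul [Fintype G] (Λ : S →ₗ[A] A) (hΛG : ∀ (g : G) s, Λ (g • s) = Λ s)
    (s t : S) :
    Λ ((∑ g : G, g • s) * t) = Λ (s * ∑ g : G, g • t) := by
  rw [Finset.sum_mul, Finset.mul_sum, map_sum, map_sum]
  refine Fintype.sum_bijective _ inv_involutive.bijective _ _ fun g => ?_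
  rw [← hΛG g (s * g⁻¹ • t), smul_mul', smul_inv_smul]

variable [SMulCommClass G A S]

/-- A linear form `τ` with `θ τ` the transfer is not concentrated over a single prime divisor of
the base. -/
lemma exists_algebraMap_mem_range_not_dvd [IsDomain A] [UniqueFactorizationMonoid A] [IsDomain S]
    [UniqueFactorizationMonoid S] [FaithfulSMul A S] [Algebra.IsIntegral A S]
    (τ : S →ₗ[FixedPoints.subalgebra A S G] FixedPoints.subalgebra A S G)
    (hf : ∀ f : S, Prime f → ∃ s, ¬ f ∣ (τ s : S)) (q : A) (hq : Prime q) :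
    ∃ (a : A) (s : S), τ s = algebraMap A (FixedPoints.subalgebra A S G) a ∧ ¬ q ∣ a := by
  by_contra! hcon
  let R := FixedPoints.subalgebra A S G
  have : Algebra.IsIntegral A R := Algebra.IsIntegral.of_injective R.val Subtype.val_injective
  have : Algebra.IsIntegral R S := Algebra.IsIntegral.tower_top (R := A)
  have hP : (Ideal.span {q}).IsPrime := (Ideal.span_singleton_prime hq.ne_zero).mpr hq
  obtain ⟨Q, hQτ, hQ, hQq⟩ := Ideal.exists_ideal_over_prime_of_isIntegral (Ideal.span {q})
    (LinearMap.range τ) (fun a ha => by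
      obtain ⟨s, hs⟩ := ha
      exact Ideal.mem_span_singleton.mpr (hcon a s hs))
  obtain ⟨M, hM, hMQ⟩ := Ideal.exists_ideal_over_prime_of_isIntegral_of_isDomain (S := S) Q (by
    rw [(RingHom.injective_iff_ker_eq_bot _).mp (FaithfulSMul.algebraMap_injective R S)]
    exact bot_le)
  have hMq : M.comap (algebraMap A S) = Ideal.span {q} := by
    rw [← hQq, ← hMQ, Ideal.comap_comap, ← IsScalarTower.algebraMap_eq]
  have hqM : algebraMap A S q ∈ M := by
    rw [← Ideal.mem_comap, hMq]; exact Ideal.mem_span_singleton_self q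
  have hq0 : algebraMap A S q ≠ 0 := by
    rw [Ne, FaithfulSMul.algebraMap_eq_zero_iff]; exact hq.ne_zero
  obtain ⟨f, hfM, hfp, hfq⟩ : ∃ f ∈ M, Prime f ∧ f ∣ algebraMap A S q := by
    obtain ⟨u, hu⟩ := UniqueFactorizationMonoid.factors_prod hq0
    have : (UniqueFactorizationMonoid.factors (algebraMap A S q)).prod ∈ M := by
      rwa [← hu, Ideal.mul_unit_mem_iff_mem _ u.isUnit] at hqM
    obtain ⟨f, hf, hfM⟩ := (hM.multiset_prod_mem_iff_exists_mem _).1 this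
    exact ⟨f, hfM, UniqueFactorizationMonoid.prime_of_factor f hf,
      UniqueFactorizationMonoid.dvd_of_mem_factors hf⟩
  have hfP : (Ideal.span {f}).IsPrime := (Ideal.span_singleton_prime hfp.ne_zero).mpr hfp
  have hfle : Ideal.span {f} ≤ M := (Ideal.span_singleton_le_iff_mem M).mpr hfM
  have hMf : M = Ideal.span {f} := by
    by_contra hne
    have hlt := Ideal.IsIntegral.comap_lt_comap (R := A) (lt_of_le_of_ne hfle (Ne.symm hne))
    refine hlt.not_ge ?_
    rw [hMq, Ideal.span_singleton_le_iff_mem, Ideal.mem_comap]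
    exact Ideal.mem_span_singleton.mpr hfq
  obtain ⟨s, hs⟩ := hf f hfp
  refine hs (Ideal.mem_span_singleton.mp ?_)
  rw [← hMf]
  have : τ s ∈ M.comap (algebraMap R S) := hMQ ▸ hQτ ⟨s, rfl⟩
  exact this

variable [Fintype G]

/-- A criterion for a ring of invariants to have finite self-injective dimension. -/
theorem hasInjectiveDimensionLE_fixedPoints [IsDomain A] [UniqueFactorizationMonoid A] [IsDomain S]
    [UniqueFactorizationMonoid S] [FaithfulSMul A S] [Algebra.IsIntegral A S]
    [Module.Projective A (FixedPoints.subalgebra A S G)]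
    (n : ℕ) [HasInjectiveDimensionLE (ModuleCat.of A A) n]
    (Λ : S →ₗ[A] A) (hΛG : ∀ (g : G) s, Λ (g • s) = Λ s)
    (hΛ : ∀ ψ : S →ₗ[A] A, ∃ s₀, ∀ s, ψ s = Λ (s₀ * s))
    (hΛ₀ : ∀ s₀, (∀ s, Λ (s₀ * s) = 0) → s₀ = 0)
    (θ : S) (hθ₀ : θ ≠ 0) (hθG : ∀ g : G, g • θ = θ) (hθ : ∀ s : S, θ ∣ ∑ g : G, g • s)
    (hf : ∀ f : S, Prime f → ∃ s, ¬ f * θ ∣ ∑ g : G, g • s)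
    (hne : ∃ s : S, ∑ g : G, g • s ≠ 0) :
    HasInjectiveDimensionLE (ModuleCat.of (FixedPoints.subalgebra A S G)
      (FixedPoints.subalgebra A S G)) n := by
  let R := FixedPoints.subalgebra A S G
  have : Algebra.IsIntegral A R := Algebra.IsIntegral.of_injective R.val Subtype.val_injective
  choose τ₀ hτ₀ using hθ
  have hτG (s : S) (g : G) : g • τ₀ s = τ₀ s := by
    apply mul_left_cancel₀ hθ₀
    have := smul_sum_smul g s
    rwa [hτ₀, smul_mul', hθG] at this
  let τ : S →ₗ[R] R :=
    { toFun := fun s => ⟨τ₀ s, hτG s⟩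
      map_add' := fun s t => Subtype.ext (mul_left_cancel₀ hθ₀ (by
        change θ * τ₀ (s + t) = θ * (τ₀ s + τ₀ t)
        rw [mul_add, ← hτ₀, ← hτ₀, ← hτ₀, ← Finset.sum_add_distrib]
        simp only [smul_add]))
      map_smul' := fun r s => Subtype.ext (mul_left_cancel₀ hθ₀ (by
        change θ * τ₀ ((r : S) * s) = θ * ((r : S) * τ₀ s)
        rw [mul_left_comm, ← hτ₀, ← hτ₀, Finset.mul_sum]
        refine Finset.sum_congr rfl fun g _ => ?_
        rw [smul_mul']
        congr 1
        exact r.2 g)) }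
  have hτ (s : S) : θ * (τ s : S) = ∑ g : G, g • s := (hτ₀ s).symm
  have hτmul (r : R) (s : S) : τ ((r : S) * s) = r * τ s := τ.map_smul r s
  have hτinv (g : G) (s : S) : τ (g • s) = τ s := by
    refine Subtype.ext (mul_left_cancel₀ hθ₀ ?_)
    rw [hτ, hτ]
    refine Fintype.sum_bijective (· * g) (Group.mulRight_bijective g) _ _ fun h => ?_
    rw [mul_smul]
  have hne' : ∃ s, τ s ≠ 0 := by
    obtain ⟨s, hs⟩ := hne
    refine ⟨s, fun h => hs ?_⟩
    rw [← hτ, h]; exact mul_zero θ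
  have hdvd (q : A) (hq : Prime q) := exists_algebraMap_mem_range_not_dvd τ (fun f hfp => by
    obtain ⟨s, hs⟩ := hf f hfp
    refine ⟨s, fun h => hs ?_⟩
    rw [← hτ, mul_comm f]
    exact mul_dvd_mul_left θ h) q hq
  have hcoe (a : A) (s : S) : ((algebraMap A R a : R) : S) * s = a • s :=
    (Algebra.smul_def a s).symm
  have hΛmul (a : A) (s : S) : a * Λ s = Λ (a • s) := (Λ.map_smul a s).symm
  have hsymm (s t : S) : Λ ((τ s : S) * t) = Λ (s * (τ t : S)) := by
    have hθR : IsIntegral A (⟨θ, hθG⟩ : R) := Algebra.IsIntegral.isIntegral _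
    obtain ⟨b, hb, θ', hθ'⟩ := hθR.isAlgebraic.exists_nonzero_dvd
      (mem_nonZeroDivisors_of_ne_zero fun h => hθ₀ (congrArg Subtype.val h))
    have hθ'' : algebraMap A S b = θ * (θ' : S) := congrArg Subtype.val hθ'
    apply mul_left_cancel₀ hb
    rw [hΛmul, hΛmul, Algebra.smul_def, Algebra.smul_def, hθ'']
    have h1 : θ * (θ' : S) * ((τ s : S) * t) = (∑ g : G, g • s) * (θ' * t) := by rw [← hτ]; ring
    have h2 : θ * (θ' : S) * (s * (τ t : S)) = s * ∑ g : G, g • ((θ' : S) * t) := by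
      rw [← hτ, hτmul]; push_cast; ring
    rw [h1, h2, map_sum_smul_mul Λ hΛG]
  obtain ⟨a₁, s₁, h₁, ha₁⟩ : ∃ (a : A) (s : S), τ s = algebraMap A R a ∧ a ≠ 0 := by
    obtain ⟨s, hs⟩ := hne'
    obtain ⟨b, hb, r, hr⟩ :=
      (Algebra.IsIntegral.isIntegral (R := A) (τ s)).isAlgebraic.exists_nonzero_dvd
      (mem_nonZeroDivisors_of_ne_zero hs)
    exact ⟨b, (r : S) * s, by rw [hτmul, hr, mul_comm], hb⟩
  have hdiv (t : R) : a₁ ∣ Λ (s₁ * t) := by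
    refine dvd_of_forall_prime_exists a₁ ha₁ _ fun q hq => ?_
    obtain ⟨a₂, s₂, h₂, ha₂⟩ := hdvd q hq
    refine ⟨a₂, Λ (s₂ * t), ?_, ha₂⟩
    rw [hΛmul, hΛmul, ← hcoe, ← hcoe, ← h₁, ← h₂, hsymm,
      mul_comm s₂ (t : S), hτmul, mul_comm (τ s₂ : S)]
    push_cast
    rw [mul_assoc]
  choose β₀ hβ₀ using hdiv
  let β : R →ₗ[A] A :=
    { toFun := β₀
      map_add' := fun r t => mul_left_cancel₀ ha₁ (by
        rw [mul_add, ← hβ₀, ← hβ₀, ← hβ₀, ← map_add]; push_cast; rw [mul_add])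
      map_smul' := fun a t => mul_left_cancel₀ ha₁ (by
        rw [← hβ₀, RingHom.id_apply, smul_eq_mul, mul_left_comm, ← hβ₀, hΛmul, ← mul_smul_comm]
        rfl) }
  have hβ (t : R) : a₁ * β t = Λ (s₁ * t) := (hβ₀ t).symm
  have hβτ (s : S) : β (τ s) = Λ s := by
    apply mul_left_cancel₀ ha₁
    rw [hβ, ← hsymm, h₁, hcoe, map_smul, smul_eq_mul]
  refine hasInjectiveDimensionLE_of_dual n β (fun r hr => ?_) fun ψ => ?_
  · refine Subtype.ext (hΛ₀ _ fun s => ?_)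
    rw [← hβτ, hτmul, hr]
  · obtain ⟨s₀, hs₀⟩ := hΛ (ψ ∘ₗ τ.restrictScalars A)
    have hs₀' (s : S) : ψ (τ s) = Λ (s₀ * s) := hs₀ s
    have hinv (g : G) : g • s₀ = s₀ := by
      rw [← sub_eq_zero]
      refine hΛ₀ _ fun s => ?_
      rw [sub_mul, map_sub, ← hs₀', ← hΛG g⁻¹, smul_mul', inv_smul_smul, ← hs₀', hτinv, sub_self]
    refine ⟨⟨s₀, hinv⟩, fun r => mul_left_cancel₀ ha₁ ?_⟩
    have h1 : τ ((r : S) * s₁) = a₁ • r := by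
      rw [hτmul, h₁, mul_comm, ← Algebra.smul_def]
    have h2 : τ ((⟨s₀, hinv⟩ : R) * ((r : S) * s₁)) = a₁ • (⟨s₀, hinv⟩ * r) := by
      rw [hτmul, h1, mul_smul_comm]
    rw [← smul_eq_mul, ← smul_eq_mul, ← map_smul, ← map_smul, ← h1, ← h2, hβτ, hs₀']

end QuasiGorenstein

lemma hasProjectiveDimensionLE_of_ringEquiv {D E : Type u} [CommRing D] [CommRing E] (e : D ≃+* E)
    (n : ℕ) (h : ∀ M : ModuleCat.{u} D, HasProjectiveDimensionLE M n) (M : ModuleCat.{u} E) :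
    HasProjectiveDimensionLE M n := by
  let _ : Module D M := Module.compHom M (e : D →+* E)
  have := h (ModuleCat.of D M)
  let _ := RingHomInvPair.of_ringEquiv e
  let _ := RingHomInvPair.of_ringEquiv e.symm
  let e' : ModuleCat.of D M ≃ₛₗ[RingHomClass.toRingHom e] M :=
    { AddEquiv.refl M with map_smul' := fun _ _ => rfl }
  exact ModuleCat.hasProjectiveDimensionLE_of_semiLinearEquiv e e' n

/-- Hilbert's syzygy theorem. -/
theorem hasProjectiveDimensionLE_mvPolynomial (F : Type u) [Field F] (n : ℕ)
    (M : ModuleCat.{u} (MvPolynomial (Fin n) F)) : HasProjectiveDimensionLE M n := by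
  induction n with
  | zero =>
    refine hasProjectiveDimensionLE_of_ringEquiv (isEmptyRingEquiv F (Fin 0)).symm 0 (fun M => ?_) M
    rw [← projective_iff_hasProjectiveDimensionLE_zero, ← IsProjective.iff_projective]
    have : Module.Free F M := Module.Free.of_divisionRing F M
    exact Module.Projective.of_free
  | succ n ih =>
    exact hasProjectiveDimensionLE_of_ringEquiv (finSuccEquiv F n).symm.toRingEquiv _
      (hasProjectiveDimensionLE_polynomial n ih) M

lemma hasInjectiveDimensionLE_of_forall_hasProjectiveDimensionLE {D : Type u} [CommRing D] (n : ℕ)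
    (h : ∀ M : ModuleCat.{u} D, HasProjectiveDimensionLE M n) (M : ModuleCat.{u} D) :
    HasInjectiveDimensionLE M n := by
  let _ := HasExt.standard (ModuleCat.{u} D)
  refine (hasInjectiveDimensionLT_iff _ _).2 fun i hi Y e => ?_
  have := h Y
  exact e.eq_zero_of_hasProjectiveDimensionLT (n + 1) hi

lemma projective_ker_of_forall_hasProjectiveDimensionLE_two {D P Q : Type u} [CommRing D]
    (h : ∀ M : ModuleCat.{u} D, HasProjectiveDimensionLE M 2)
    [AddCommGroup P] [Module D P] [AddCommGroup Q] [Module D Q] [Module.Projective D P]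
    [Module.Projective D Q] (f : P →ₗ[D] Q) : Module.Projective D (LinearMap.ker f) := by
  have hP : HasProjectiveDimensionLE (ModuleCat.of D P) 0 := by
    rw [← projective_iff_hasProjectiveDimensionLE_zero, ← IsProjective.iff_projective]
    assumption
  have hQ : HasProjectiveDimensionLE (ModuleCat.of D Q) 0 := by
    rw [← projective_iff_hasProjectiveDimensionLE_zero, ← IsProjective.iff_projective]
    assumption
  have h₁ := LinearMap.shortExact_shortComplexKer f.range.mkQ_surjective
  have hr : HasProjectiveDimensionLE (ModuleCat.of D (LinearMap.range f)) 1 := by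
    have : HasProjectiveDimensionLE (ModuleCat.of D (LinearMap.ker f.range.mkQ)) 1 :=
      h₁.hasProjectiveDimensionLT_X₁ 2 (hasProjectiveDimensionLT_of_ge _ 1 2 (by norm_num)) (h _)
    rwa [Submodule.ker_mkQ] at this
  have h₂ := LinearMap.shortExact_shortComplexKer f.surjective_rangeRestrict
  have hk : HasProjectiveDimensionLE (ModuleCat.of D (LinearMap.ker f.rangeRestrict)) 0 :=
    h₂.hasProjectiveDimensionLT_X₁ 1 hP hr
  rw [LinearMap.ker_rangeRestrict] at hk
  rwa [← projective_iff_hasProjectiveDimensionLE_zero, ← IsProjective.iff_projective] at hk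

lemma projective_restrictScalars (A B M : Type*) [CommRing A] [CommRing B] [Algebra A B]
    [AddCommGroup M] [Module A M] [Module B M] [IsScalarTower A B M] [Module.Projective A B]
    [Module.Projective B M] : Module.Projective A M := by
  obtain ⟨s, hs⟩ := Module.Projective.out (R := B) (P := M)
  have : Module.Projective A (M →₀ B) := by
    classical
    exact Module.Projective.of_equiv (finsuppLequivDFinsupp A (ι := M) (M := B)).symm
  exact Module.Projective.of_split (s.restrictScalars A)
    ((Finsupp.linearCombination B id).restrictScalars A) (LinearMap.ext hs)

/-- A ring homomorphism `φ : A →+* S` is Frobenius if there is an `A`-linear form `Λ` on `S`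
admitting a dual basis. -/
def IsFrobeniusHom {A S : Type*} [CommRing A] [CommRing S] (φ : A →+* S) : Prop :=
  ∃ (Λ : S →+ A) (ι : Type) (_ : Fintype ι) (e e' : ι → S),
    (∀ a s, Λ (φ a * s) = a * Λ s) ∧ ∀ s, s = ∑ i, φ (Λ (s * e' i)) * e i

namespace IsFrobeniusHom

variable {A S T : Type*} [CommRing A] [CommRing S] [CommRing T]

lemma of_ringEquiv (e : A ≃+* S) : IsFrobeniusHom (e : A →+* S) := by
  refine ⟨e.symm, Unit, inferInstance, 1, 1, fun a s => ?_, fun s => ?_⟩ <;> simp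

lemma comp {χ : S →+* T} {φ : A →+* S} (hχ : IsFrobeniusHom χ) (hφ : IsFrobeniusHom φ) :
    IsFrobeniusHom (χ.comp φ) := by
  obtain ⟨Λ₁, ι₁, _, e₁, e₁', hl₁, hs₁⟩ := hφ
  obtain ⟨Λ₂, ι₂, _, e₂, e₂', hl₂, hs₂⟩ := hχ
  refine ⟨Λ₁.comp Λ₂, ι₁ × ι₂, inferInstance, fun i => χ (e₁ i.1) * e₂ i.2,
    fun i => χ (e₁' i.1) * e₂' i.2, fun a s => ?_, fun s => ?_⟩
  · simp [hl₁, hl₂]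
  · conv_lhs => rw [hs₂ s]
    rw [Fintype.sum_prod_type, Finset.sum_comm]
    refine Finset.sum_congr rfl fun j _ => ?_
    conv_lhs => rw [hs₁ (Λ₂ (s * e₂' j)), map_sum, Finset.sum_mul]
    refine Finset.sum_congr rfl fun i _ => ?_
    rw [mul_left_comm s, AddMonoidHom.comp_apply, hl₂, mul_comm (e₁' i), RingHom.comp_apply,
      _root_.map_mul, mul_assoc]

lemma injective [IsDomain A] [Nontrivial S] {φ : A →+* S} (h : IsFrobeniusHom φ) :
    Function.Injective φ := by
  obtain ⟨Λ, ι, _, e, e', hl, hs⟩ := h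
  rw [injective_iff_map_eq_zero]
  intro a ha
  by_contra ha0
  have hΛ (s : S) : Λ s = 0 := by
    have := hl a s
    rw [ha, zero_mul, map_zero] at this
    exact (mul_eq_zero.mp this.symm).resolve_left ha0
  have := hs 1
  simp [hΛ] at this

variable [Algebra A S]

lemma projective (h : IsFrobeniusHom (algebraMap A S)) : Module.Projective A S := by
  obtain ⟨Λ, ι, _, e, e', hl, hs⟩ := h
  let i : S →ₗ[A] (ι → A) :=
    { toFun := fun s i => Λ (s * e' i)
      map_add' := fun s t => by ext; simp [add_mul]
      map_smul' := fun a s => by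
        ext j
        rw [Algebra.smul_def, mul_assoc, hl]
        rfl }
  refine Module.Projective.of_split i (Fintype.linearCombination A e) (LinearMap.ext fun s => ?_)
  conv_rhs => rw [LinearMap.id_apply, hs s]
  rw [LinearMap.comp_apply, Fintype.linearCombination_apply]
  simp only [Algebra.smul_def]
  rfl

lemma finite (h : IsFrobeniusHom (algebraMap A S)) : Module.Finite A S := by
  obtain ⟨Λ, ι, _, e, e', hl, hs⟩ := h
  refine Module.Finite.of_surjective (Fintype.linearCombination A e) fun s => ⟨fun i =>
    Λ (s * e' i), ?_⟩
  conv_rhs => rw [hs s]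
  rw [Fintype.linearCombination_apply]
  simp only [Algebra.smul_def]

lemma exists_linearMap (h : IsFrobeniusHom (algebraMap A S)) : ∃ Λ : S →ₗ[A] A,
    (∀ ψ : S →ₗ[A] A, ∃ s₀, ∀ s, ψ s = Λ (s₀ * s)) ∧ ∀ s₀, (∀ s, Λ (s₀ * s) = 0) → s₀ = 0 := by
  obtain ⟨Λ, ι, _, e, e', hl, hs⟩ := h
  let Λ' : S →ₗ[A] A := { Λ with map_smul' := fun a s => by rw [Algebra.smul_def]; exact hl a s }
  refine ⟨Λ', fun ψ => ⟨∑ i, algebraMap A S (ψ (e i)) * e' i, fun s => ?_⟩, fun s₀ h₀ => ?_⟩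
  · conv_lhs => rw [hs s]
    rw [Finset.sum_mul, map_sum, map_sum]
    refine Finset.sum_congr rfl fun i _ => ?_
    rw [← Algebra.smul_def, map_smul, smul_eq_mul, mul_comm, mul_assoc, mul_comm (e' i)]
    exact (hl _ _).symm
  · rw [hs s₀]
    refine Finset.sum_eq_zero fun i _ => ?_
    have : Λ (s₀ * e' i) = 0 := h₀ (e' i)
    rw [this, map_zero, zero_mul]

end IsFrobeniusHom

section Division

variable {D : Type*} [CommRing D]

/-- Uniqueness of the expansion in powers of a monic polynomial. -/
lemma Polynomial.Monic.eq_zero_of_sum_pow_mul_eq_zero {N : Polynomial D} (hN : N.Monic) (n : ℕ)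
    (g : ℕ → Polynomial D) (hg : ∀ i, (g i).degree < N.degree)
    (h : ∑ i ∈ Finset.range n, N ^ i * g i = 0) : ∀ i < n, g i = 0 := by
  induction n generalizing g with
  | zero => simp
  | succ n ih =>
    rw [Finset.sum_range_succ'] at h
    have h' : g 0 + N * ∑ i ∈ Finset.range n, N ^ i * g (i + 1) = 0 := by
      rw [← h, Finset.mul_sum, pow_zero, one_mul, add_comm]
      simp only [pow_succ', mul_assoc]
    nontriviality D
    obtain ⟨h₁, h₂⟩ := Polynomial.div_modByMonic_unique _ _ hN ⟨h', hg 0⟩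
    rw [Polynomial.zero_divByMonic] at h₁
    rw [Polynomial.zero_modByMonic] at h₂
    rintro (_ | i) hi
    · exact h₂.symm
    · exact ih (fun i => g (i + 1)) (fun i => hg _) h₁.symm i (by omega)

/-- Induction along division by a monic polynomial of positive degree. -/
lemma Polynomial.Monic.induction_divByMonic [Nontrivial D] {N : Polynomial D} (hN : N.Monic)
    (hd : 0 < N.natDegree) {motive : Polynomial D → Prop} (h0 : motive 0)
    (h : ∀ s, motive (s /ₘ N) → motive s) (s : Polynomial D) : motive s := by
  induction hs : s.natDegree using Nat.strong_induction_on generalizing s with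
  | _ n ih =>
    by_cases hsN : s /ₘ N = 0
    · exact h s (hsN ▸ h0)
    · refine h s (ih _ ?_ _ rfl)
      have : N.natDegree ≤ s.natDegree := by
        by_contra! hlt
        exact hsN ((Polynomial.divByMonic_eq_zero_iff hN).2
          (Polynomial.degree_lt_degree hlt))
      rw [Polynomial.natDegree_divByMonic s hN]
      omega

end Division

lemma IsFrobeniusHom.of_pow {E S : Type*} [CommRing E] [CommRing S] {φ : E →+* S} (t : S) (d : ℕ)
    (hd : 0 < d) (hex : ∀ s, ∃ a : Fin d → E, ∑ j, φ (a j) * t ^ (j : ℕ) = s)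
    (hu : ∀ a : Fin d → E, ∑ j, φ (a j) * t ^ (j : ℕ) = 0 → a = 0) : IsFrobeniusHom φ := by
  let _ := φ.toAlgebra
  have hφ (a : E) (s : S) : a • s = φ a * s := Algebra.smul_def a s
  let f : (Fin d → E) →ₗ[E] S := Fintype.linearCombination E (fun j : Fin d => t ^ (j : ℕ))
  have hf (a : Fin d → E) : f a = ∑ j, φ (a j) * t ^ (j : ℕ) := by
    rw [Fintype.linearCombination_apply]
    simp only [hφ]
  have hbij : Function.Bijective f := ⟨(injective_iff_map_eq_zero f).2 fun a ha => hu a (hf a ▸ ha),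
    fun s => (hex s).imp fun a ha => (hf a).trans ha⟩
  let b : Module.Basis (Fin d) E S := .ofEquivFun (LinearEquiv.ofBijective f hbij).symm
  have hb (j : Fin d) : b j = t ^ (j : ℕ) := by
    rw [Module.Basis.coe_ofEquivFun, LinearEquiv.symm_symm]
    change f (Pi.single j 1) = _
    rw [hf, Finset.sum_eq_single j]
    · simp
    · intro i _ hij
      simp [hij]
    · simp
  let Λ : S →ₗ[E] E := b.coord ⟨d - 1, by omega⟩
  have hΛ (k : Fin d) : Λ (t ^ (k : ℕ)) = if (k : ℕ) = d - 1 then 1 else 0 := by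
    rw [← hb, Module.Basis.coord_apply, Module.Basis.repr_self, Finsupp.single_apply]
    simp only [Fin.ext_iff]
  let H : Matrix (Fin d) (Fin d) E := fun i j => Λ (t ^ ((i.rev : ℕ) + j))
  have hH : H.det = 1 := by
    rw [Matrix.det_of_isUpperTriangular]
    · refine Finset.prod_eq_one fun i _ => ?_
      have hi : (i.rev : ℕ) + i = d - 1 := by rw [Fin.val_rev]; omega
      change Λ (t ^ ((i.rev : ℕ) + i)) = 1
      rw [hi]
      exact (hΛ ⟨d - 1, by omega⟩).trans (if_pos rfl)
    · intro i j hij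
      have hij' : (j : ℕ) < i := hij
      have hi : (i.rev : ℕ) + j < d - 1 := by rw [Fin.val_rev]; omega
      exact (hΛ ⟨(i.rev : ℕ) + j, by omega⟩).trans (if_neg hi.ne)
  have hHH : H⁻¹ * H = 1 := Matrix.nonsing_inv_mul H (by rw [hH]; exact isUnit_one)
  let e' : Fin d → S := fun j => ∑ k, H⁻¹ j k • t ^ (k.rev : ℕ)
  have key (i j : Fin d) : Λ (b i * e' j) = (1 : Matrix (Fin d) (Fin d) E) j i := by
    rw [← hHH, Matrix.mul_apply, hb, Finset.mul_sum, map_sum]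
    refine Finset.sum_congr rfl fun k _ => ?_
    rw [mul_smul_comm, map_smul, ← pow_add, add_comm, smul_eq_mul]
  let g : S →ₗ[E] S :=
    ∑ j, (LinearMap.toSpanSingleton E S (b j)) ∘ₗ Λ ∘ₗ LinearMap.mulRight E (e' j)
  have hg : g = LinearMap.id := b.ext fun i => by
    simp only [g, LinearMap.sum_apply, LinearMap.comp_apply, LinearMap.mulRight_apply, key,
      LinearMap.toSpanSingleton_apply, Matrix.one_apply, ite_smul, one_smul, zero_smul,
      Finset.sum_ite_eq', Finset.mem_univ, if_true, LinearMap.id_apply]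
  refine ⟨Λ.toAddMonoidHom, Fin d, inferInstance, b, e', fun a s => ?_, fun s => ?_⟩
  · rw [← hφ]
    exact Λ.map_smul a s
  · conv_lhs => rw [← LinearMap.id_apply (R := E) s, ← hg]
    simp only [g, LinearMap.sum_apply, LinearMap.comp_apply, LinearMap.mulRight_apply,
      LinearMap.toSpanSingleton_apply, hφ]
    rfl

lemma isFrobeniusHom_compRingHom {D : Type*} [CommRing D] [Nontrivial D] {h : Polynomial D}
    (hm : h.Monic) (hd : 0 < h.natDegree) : IsFrobeniusHom (Polynomial.compRingHom h) := by
  have hX (r : Polynomial D) (hr : r.degree < h.degree) :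
      ∑ j : Fin h.natDegree, Polynomial.C (r.coeff j) * Polynomial.X ^ (j : ℕ) = r := by
    rw [Fin.sum_univ_eq_sum_range (fun j => Polynomial.C (r.coeff j) * Polynomial.X ^ j)]
    refine (r.as_sum_range_C_mul_X_pow' ?_).symm
    rw [Polynomial.degree_eq_natDegree hm.ne_zero] at hr
    by_cases hr0 : r = 0
    · simpa [hr0] using hd
    · exact (Polynomial.natDegree_lt_iff_degree_lt hr0).2 hr
  refine IsFrobeniusHom.of_pow Polynomial.X h.natDegree hd (fun s => ?_) fun a ha => ?_
  · induction s using hm.induction_divByMonic hd with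
    | h0 => exact ⟨0, by simp⟩
    | h s ih =>
      obtain ⟨a, ha⟩ := ih
      refine ⟨fun j => Polynomial.X * a j + Polynomial.C ((s %ₘ h).coeff j), ?_⟩
      conv_rhs => rw [← Polynomial.modByMonic_add_div s h, ← ha,
        ← hX _ (Polynomial.degree_modByMonic_lt s hm), Finset.mul_sum, add_comm,
        ← Finset.sum_add_distrib]
      refine Finset.sum_congr rfl fun j _ => ?_
      simp [add_mul, mul_assoc]
  · let g : ℕ → Polynomial D := fun i =>
      ∑ j : Fin h.natDegree, Polynomial.C ((a j).coeff i) * Polynomial.X ^ (j : ℕ)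
    have hg (i : ℕ) : (g i).degree < h.degree := by
      rw [Polynomial.degree_eq_natDegree hm.ne_zero]
      exact Polynomial.degree_sum_fin_lt _
    obtain ⟨n, hn⟩ : ∃ n : ℕ, ∀ j, (a j).natDegree < n :=
      ⟨Finset.univ.sup (fun j => (a j).natDegree) + 1, fun j => Nat.lt_succ_of_le
        (Finset.le_sup (f := fun j => (a j).natDegree) (Finset.mem_univ j))⟩
    have hsum : ∑ i ∈ Finset.range n, h ^ i * g i = 0 := by
      rw [← ha]
      simp only [g, Finset.mul_sum]
      rw [Finset.sum_comm]
      refine Finset.sum_congr rfl fun j _ => ?_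
      conv_rhs => rw [(a j).as_sum_range_C_mul_X_pow' (hn j), map_sum, Finset.sum_mul]
      refine Finset.sum_congr rfl fun i _ => ?_
      simp
      ring
    have h0 := hm.eq_zero_of_sum_pow_mul_eq_zero n g hg hsum
    ext j i
    by_cases hi : i < n
    · have := congrArg (Polynomial.coeff · (j : ℕ)) (h0 i hi)
      simp only [g, Polynomial.finsetSum_coeff, Polynomial.coeff_C_mul, Polynomial.coeff_X_pow,
        Polynomial.coeff_zero, mul_ite, mul_one, mul_zero, ← Fin.ext_iff] at this
      simpa using this
    · rw [Polynomial.coeff_eq_zero_of_natDegree_lt ((hn j).trans_le (not_lt.mp hi))]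
      rfl

section PolyAct

variable {F : Type u} [Field F] {n : ℕ}

/-- The linear polynomial with coefficient vector `v`. -/
def linearForm (v : Fin n → F) : MvPolynomial (Fin n) F := ∑ i, v i • X i

lemma polyAct_X (M : Matrix (Fin n) (Fin n) F) (i : Fin n) :
    polyAct M (X i) = linearForm (M i) := by
  simp [polyAct, linearForm]

lemma polyAct_linearForm (M : Matrix (Fin n) (Fin n) F) (v : Fin n → F) :
    polyAct M (linearForm v) = linearForm (v ᵥ* M) := by
  rw [linearForm, map_sum]
  simp only [map_smul, polyAct_X, linearForm, Matrix.vecMul, dotProduct, Finset.sum_smul,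
    Finset.smul_sum, smul_smul]
  exact Finset.sum_comm

lemma polyAct_one : polyAct (1 : Matrix (Fin n) (Fin n) F) = AlgHom.id F _ := by
  refine MvPolynomial.algHom_ext fun i => ?_
  rw [polyAct_X, linearForm, Finset.sum_eq_single i] <;> simp +contextual [Matrix.one_apply]
  intro j hj h; exact absurd h.symm hj

lemma polyAct_polyAct (M N : Matrix (Fin n) (Fin n) F) (s : MvPolynomial (Fin n) F) :
    polyAct M (polyAct N s) = polyAct (N * M) s := by
  rw [← AlgHom.comp_apply]
  congr 1
  refine MvPolynomial.algHom_ext fun i => ?_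
  rw [AlgHom.comp_apply, polyAct_X, polyAct_X, polyAct_linearForm]
  rfl

/-- The action of the general linear group on polynomials by substitution. -/
@[reducible] def glAction : MulSemiringAction (GL (Fin n) F) (MvPolynomial (Fin n) F) where
  smul g s := polyAct (g⁻¹ : GL (Fin n) F).1 s
  one_smul s := by
    change polyAct (1⁻¹ : GL (Fin n) F).1 s = s
    rw [inv_one, Units.val_one, polyAct_one]; rfl
  mul_smul g h s := by
    change polyAct ((g * h)⁻¹ : GL (Fin n) F).1 s = polyAct _ (polyAct _ s)
    rw [polyAct_polyAct, _root_.mul_inv_rev, Units.val_mul]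
  smul_zero g := map_zero _
  smul_add g := map_add _
  smul_one g := map_one _
  smul_mul g := map_mul _

attribute [local instance] glAction

lemma gl_smul_def (g : GL (Fin n) F) (s : MvPolynomial (Fin n) F) :
    g • s = polyAct (g⁻¹ : GL (Fin n) F).1 s := rfl

lemma gl_smul_C (g : GL (Fin n) F) (c : F) : g • (C c : MvPolynomial (Fin n) F) = C c :=
  (polyAct (g⁻¹ : GL (Fin n) F).1).commutes c

lemma gl_smul_smul (g : GL (Fin n) F) (c : F) (s : MvPolynomial (Fin n) F) :
    g • (c • s) = c • g • s := map_smul _ _ _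

lemma gl_smul_linearForm (g : GL (Fin n) F) (v : Fin n → F) :
    g • linearForm v = linearForm (v ᵥ* (g⁻¹ : GL (Fin n) F).1) := polyAct_linearForm _ _

lemma linearForm_add (v w : Fin n → F) : linearForm (v + w) = linearForm v + linearForm w := by
  simp [linearForm, add_smul, Finset.sum_add_distrib]

lemma linearForm_smul (c : F) (v : Fin n → F) : linearForm (c • v) = c • linearForm v := by
  simp [linearForm, Finset.smul_sum, smul_smul]

lemma coeff_linearForm (v : Fin n → F) (i : Fin n) :
    coeff (Finsupp.single i 1) (linearForm v) = v i := by
  rw [linearForm, coeff_sum, Finset.sum_eq_single i]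
  · simp
  · intro j _ hj
    simp [coeff_X, Finsupp.single_left_inj, hj]
  · simp

lemma linearForm_injective : Function.Injective (linearForm (F := F) (n := n)) := fun v w h => by
  ext i
  rw [← coeff_linearForm v, h, coeff_linearForm]

lemma linearForm_eq_zero {v : Fin n → F} : linearForm v = 0 ↔ v = 0 := by
  rw [← linearForm_injective.eq_iff]
  simp [linearForm]

/-- Substitution of `h` for the variable `X i`. -/
def substVar (i : Fin n) (h : MvPolynomial (Fin n) F) :
    MvPolynomial (Fin n) F →ₐ[F] MvPolynomial (Fin n) F :=
  aeval (Function.update X i h)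

lemma substVar_X_self (i : Fin n) (h : MvPolynomial (Fin n) F) : substVar i h (X i) = h := by
  simp [substVar]

lemma substVar_X_of_ne {i j : Fin n} (h : MvPolynomial (Fin n) F) (hj : j ≠ i) :
    substVar i h (X j) = X j := by
  simp [substVar, hj]

/-- The polynomial ring as a univariate polynomial ring in the `i`-th variable. -/
def isolateVar (i : Fin (n + 1)) :
    MvPolynomial (Fin (n + 1)) F ≃ₐ[F] Polynomial (MvPolynomial (Fin n) F) :=
  (renameEquiv F (Equiv.swap 0 i)).trans (finSuccEquiv F n)

lemma isolateVar_X_self (i : Fin (n + 1)) : isolateVar (F := F) i (X i) = Polynomial.X := by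
  simp [isolateVar, finSuccEquiv_X_zero]

lemma isolateVar_X_of_ne {i j : Fin (n + 1)} (hj : j ≠ i) :
    ∃ k, isolateVar (F := F) i (X j) = Polynomial.C (X k) := by
  have h : Equiv.swap 0 i j ≠ 0 := fun h => hj (by
    have := congrArg (Equiv.swap 0 i) h
    rwa [Equiv.swap_apply_self, Equiv.swap_apply_left] at this)
  obtain ⟨k, hk⟩ := Fin.exists_succ_eq.2 h
  refine ⟨k, ?_⟩
  rw [isolateVar, AlgEquiv.trans_apply, renameEquiv_apply, rename_X, ← hk, finSuccEquiv_X_succ]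

lemma isFrobeniusHom_substVar (i : Fin (n + 1)) (h : MvPolynomial (Fin (n + 1)) F)
    (hm : (isolateVar i h).Monic) (hd : 0 < (isolateVar i h).natDegree) :
    IsFrobeniusHom (substVar i h).toRingHom := by
  have h₁ := isFrobeniusHom_compRingHom hm hd
  have h₂ := ((IsFrobeniusHom.of_ringEquiv (isolateVar (F := F) i).symm.toRingEquiv).comp h₁).comp
    (IsFrobeniusHom.of_ringEquiv (isolateVar (F := F) i).toRingEquiv)
  convert h₂ using 1
  refine MvPolynomial.ringHom_ext (fun c => ?_) fun j => ?_
  · have : (isolateVar i) (C c) = Polynomial.C (C c : MvPolynomial (Fin n) F) :=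
      (isolateVar (F := F) i).commutes c
    have h₃ : (substVar i h) (C c) = C c := (substVar i h).commutes c
    simp [this, h₃]
    rw [← this, AlgEquiv.symm_apply_apply]
  · by_cases hj : j = i
    · subst hj
      simp [isolateVar_X_self, substVar_X_self]
    · obtain ⟨k, hk⟩ := isolateVar_X_of_ne (F := F) hj
      simp [hk, substVar_X_of_ne h hj]
      rw [← hk, AlgEquiv.symm_apply_apply]

end PolyAct

section Dickson

variable (p : ℕ) [Fact p.Prime]

lemma dickson_identity {R : Type*} [CommRing R] [CharP R p] (a b c t : R) :
    ((t ^ p - a * t) ^ p - b * (t ^ p - a * t)) ^ p -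
      c * ((t ^ p - a * t) ^ p - b * (t ^ p - a * t))
      = t ^ p ^ 3 - (c + b ^ p + a ^ p ^ 2) * t ^ p ^ 2
        - (b ^ (p + 1) - (c + b ^ p + a ^ p ^ 2 - a ^ p ^ 2) * (a ^ p + b)) * t ^ p
        - (a ^ (p ^ 2 + p + 1) - (c + b ^ p + a ^ p ^ 2) * a ^ (p + 1)
          - (b ^ (p + 1) - (c + b ^ p + a ^ p ^ 2 - a ^ p ^ 2) * (a ^ p + b)) * a) * t := by
  simp only [sub_pow_char, mul_pow, ← pow_mul]
  ring

/-- The norm of `X 1` with respect to translations by multiples of `X 2`. -/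
def normOne : MvPolynomial (Fin 3) (ZMod p) := X 1 ^ p - X 2 ^ (p - 1) * X 1

/-- The norm of `X 0` with respect to translations by combinations of `X 1` and `X 2`. -/
def normZero : MvPolynomial (Fin 3) (ZMod p) :=
  (X 0 ^ p - X 2 ^ (p - 1) * X 0) ^ p - normOne p ^ (p - 1) * (X 0 ^ p - X 2 ^ (p - 1) * X 0)

/-- The top Dickson invariant. -/
def dicksonTop : MvPolynomial (Fin 3) (ZMod p) :=
  normZero p ^ (p - 1) + (normOne p ^ (p - 1)) ^ p + (X 2 ^ (p - 1)) ^ p ^ 2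

/-- The inclusion of the polynomial ring generated by `dicksonTop`, `normOne` and `X 2`. -/
def baseHom : MvPolynomial (Fin 3) (ZMod p) →ₐ[ZMod p] MvPolynomial (Fin 3) (ZMod p) :=
  aeval ![dicksonTop p, normOne p, X 2]

/-- The inclusion of the Dickson algebra in the polynomial ring generated by `dicksonTop`,
`normOne` and `X 2`. -/
def towerHom : MvPolynomial (Fin 3) (ZMod p) →ₐ[ZMod p] MvPolynomial (Fin 3) (ZMod p) :=
  (substVar 1 ((X 1 ^ (p - 1)) ^ (p + 1) -
    (X 0 - (X 2 ^ (p - 1)) ^ p ^ 2) * ((X 2 ^ (p - 1)) ^ p + X 1 ^ (p - 1)))).comp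
  (substVar 2 ((X 2 ^ (p - 1)) ^ (p ^ 2 + p + 1) - X 0 * (X 2 ^ (p - 1)) ^ (p + 1)
    - X 1 * X 2 ^ (p - 1)))

/-- The inclusion of the Dickson algebra. -/
def dicksonHom : MvPolynomial (Fin 3) (ZMod p) →ₐ[ZMod p] MvPolynomial (Fin 3) (ZMod p) :=
  (baseHom p).comp (towerHom p)

lemma baseHom_X_zero : baseHom p (X 0) = dicksonTop p := by simp [baseHom]
lemma baseHom_X_one : baseHom p (X 1) = normOne p := by simp [baseHom]
lemma baseHom_X_two : baseHom p (X 2) = X 2 := by simp [baseHom]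

lemma towerHom_X_zero : towerHom p (X 0) = X 0 := by
  rw [towerHom, AlgHom.comp_apply, substVar_X_of_ne _ (by decide), substVar_X_of_ne _ (by decide)]

lemma towerHom_X_one : towerHom p (X 1) = (X 1 ^ (p - 1)) ^ (p + 1) -
    (X 0 - (X 2 ^ (p - 1)) ^ p ^ 2) * ((X 2 ^ (p - 1)) ^ p + X 1 ^ (p - 1)) := by
  rw [towerHom, AlgHom.comp_apply, substVar_X_of_ne _ (by decide), substVar_X_self]

lemma towerHom_X_two : towerHom p (X 2) = (X 2 ^ (p - 1)) ^ (p ^ 2 + p + 1)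
    - X 0 * (X 2 ^ (p - 1)) ^ (p + 1) - towerHom p (X 1) * X 2 ^ (p - 1) := by
  rw [towerHom_X_one, towerHom, AlgHom.comp_apply, substVar_X_self]
  simp only [map_sub, map_mul, map_pow]
  rw [substVar_X_of_ne _ (by decide), substVar_X_of_ne _ (by decide), substVar_X_self]

lemma dicksonHom_X_zero : dicksonHom p (X 0) = dicksonTop p := by
  rw [dicksonHom, AlgHom.comp_apply, towerHom_X_zero, baseHom_X_zero]

lemma dicksonHom_X_one : dicksonHom p (X 1) = (normOne p ^ (p - 1)) ^ (p + 1) -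
    (dicksonTop p - (X 2 ^ (p - 1)) ^ p ^ 2) * ((X 2 ^ (p - 1)) ^ p + normOne p ^ (p - 1)) := by
  rw [dicksonHom, AlgHom.comp_apply, towerHom_X_one]
  simp only [map_sub, map_mul, map_pow, map_add, baseHom_X_zero, baseHom_X_one, baseHom_X_two]

lemma dicksonHom_X_two : dicksonHom p (X 2) = (X 2 ^ (p - 1)) ^ (p ^ 2 + p + 1)
    - dicksonTop p * (X 2 ^ (p - 1)) ^ (p + 1) - dicksonHom p (X 1) * X 2 ^ (p - 1) := by
  rw [dicksonHom, AlgHom.comp_apply, towerHom_X_two]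
  simp only [map_sub, map_mul, map_pow, baseHom_X_zero, baseHom_X_two]
  rfl

/-- The additive polynomial with coefficients the Dickson invariants. -/
def dicksonMap : MvPolynomial (Fin 3) (ZMod p) →ₗ[ZMod p] MvPolynomial (Fin 3) (ZMod p) where
  toFun t := t ^ p ^ 3 - dicksonHom p (X 0) * t ^ p ^ 2 - dicksonHom p (X 1) * t ^ p
    - dicksonHom p (X 2) * t
  map_add' s t := by
    have h := add_pow_char_pow (R := MvPolynomial (Fin 3) (ZMod p)) (p := p)
    rw [h, h, add_pow_char]
    ring
  map_smul' c t := by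
    simp only [smul_pow, ZMod.pow_card_pow, ZMod.pow_card, mul_smul_comm, smul_sub,
      RingHom.id_apply]

lemma dicksonMap_apply (t : MvPolynomial (Fin 3) (ZMod p)) : dicksonMap p t =
    t ^ p ^ 3 - dicksonHom p (X 0) * t ^ p ^ 2 - dicksonHom p (X 1) * t ^ p
    - dicksonHom p (X 2) * t := rfl

lemma dicksonMap_eq (t : MvPolynomial (Fin 3) (ZMod p)) : dicksonMap p t =
    ((t ^ p - X 2 ^ (p - 1) * t) ^ p - normOne p ^ (p - 1) * (t ^ p - X 2 ^ (p - 1) * t)) ^ p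
      - normZero p ^ (p - 1) * ((t ^ p - X 2 ^ (p - 1) * t) ^ p
        - normOne p ^ (p - 1) * (t ^ p - X 2 ^ (p - 1) * t)) := by
  rw [dickson_identity, dicksonMap_apply, dicksonHom_X_two, dicksonHom_X_one, dicksonHom_X_zero,
    dicksonTop]

lemma dicksonMap_linearForm (v : Fin 3 → ZMod p) : dicksonMap p (linearForm v) = 0 := by
  have hp : p ≠ 0 := (Fact.out : p.Prime).ne_zero
  have h2 : (X 2 ^ p - X 2 ^ (p - 1) * X 2 : MvPolynomial (Fin 3) (ZMod p)) = 0 := by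
    rw [pow_sub_one_mul hp, sub_self]
  rw [linearForm, map_sum]
  refine Finset.sum_eq_zero fun i _ => ?_
  rw [map_smul, dicksonMap_eq]
  fin_cases i
  · change v 0 • (normZero p ^ p - normZero p ^ (p - 1) * normZero p) = 0
    rw [pow_sub_one_mul hp, sub_self, smul_zero]
  · change v 1 • ((normOne p ^ p - normOne p ^ (p - 1) * normOne p) ^ p - normZero p ^ (p - 1) *
      (normOne p ^ p - normOne p ^ (p - 1) * normOne p)) = 0
    rw [pow_sub_one_mul hp, sub_self, zero_pow hp, mul_zero, sub_zero, smul_zero]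
  · change v 2 • (((X 2 ^ p - X 2 ^ (p - 1) * X 2) ^ p - normOne p ^ (p - 1) *
      (X 2 ^ p - X 2 ^ (p - 1) * X 2)) ^ p - normZero p ^ (p - 1) *
      ((X 2 ^ p - X 2 ^ (p - 1) * X 2) ^ p - normOne p ^ (p - 1) *
      (X 2 ^ p - X 2 ^ (p - 1) * X 2))) = 0
    rw [h2]
    simp [hp]

attribute [local instance] glAction

lemma gl_smul_dicksonHom (g : GL (Fin 3) (ZMod p)) (a : MvPolynomial (Fin 3) (ZMod p)) :
    g • dicksonHom p a = dicksonHom p a := by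
  have hp1 : 1 < p := (Fact.out : p.Prime).one_lt
  set M := (g⁻¹ : GL (Fin 3) (ZMod p)).1 with hM
  let d : Fin 3 → MvPolynomial (Fin 3) (ZMod p) := fun i =>
    g • dicksonHom p (X i) - dicksonHom p (X i)
  let Q : Polynomial (MvPolynomial (Fin 3) (ZMod p)) := Polynomial.C (d 0) * Polynomial.X ^ p ^ 2 +
    Polynomial.C (d 1) * Polynomial.X ^ p + Polynomial.C (d 2) * Polynomial.X
  have hpp : p < p ^ 2 := by nlinarith
  have hppp : p ^ 2 < p ^ 3 := Nat.pow_lt_pow_right hp1 (by norm_num)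
  have hQ : Q = 0 := by
    refine Polynomial.eq_zero_of_natDegree_lt_card_of_eval_eq_zero Q
      (linearForm_injective (F := ZMod p) (n := 3)) (fun v => ?_) ?_
    · obtain ⟨w, rfl⟩ : ∃ w, w ᵥ* M = v := ⟨v ᵥ* g.1, by
        rw [Matrix.vecMul_vecMul, hM, Units.mul_inv, Matrix.vecMul_one]⟩
      have h₁ := congrArg (g • ·) (dicksonMap_linearForm p w)
      have h₂ := dicksonMap_linearForm p (w ᵥ* M)
      simp only [dicksonMap_apply, smul_sub, smul_mul', smul_pow', smul_zero, gl_smul_linearForm,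
        ← hM] at h₁ h₂
      simp only [Q, d, Polynomial.eval_add, Polynomial.eval_mul, Polynomial.eval_C,
        Polynomial.eval_pow, Polynomial.eval_X]
      linear_combination h₂ - h₁
    · rw [Fintype.card_fun, ZMod.card, Fintype.card_fin]
      refine lt_of_le_of_lt ?_ hppp
      simp only [Q]
      compute_degree
      omega
  have hd : ∀ i, d i = 0 := by
    have h0 := congrArg (Polynomial.coeff · (p ^ 2)) hQ
    have h1 := congrArg (Polynomial.coeff · p) hQ
    have h2 := congrArg (Polynomial.coeff · 1) hQ
    simp only [Q, Polynomial.coeff_add, Polynomial.coeff_C_mul, Polynomial.coeff_X_pow,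
      Polynomial.coeff_X, Polynomial.coeff_zero, hpp.ne, hpp.ne', hp1.ne,
      (hp1.trans hpp).ne, if_true, if_false, mul_one, mul_zero, add_zero,
      zero_add] at h0 h1 h2
    intro i
    fin_cases i
    exacts [h0, h1, h2]
  have : (polyAct M).comp (dicksonHom p) = dicksonHom p :=
    MvPolynomial.algHom_ext fun i => sub_eq_zero.mp (hd i)
  exact congrArg (fun f : _ →ₐ[ZMod p] _ => f a) this

end Dickson

lemma Polynomial.monic_X_pow_add_and_natDegree_pos {R : Type*} [CommRing R] [Nontrivial R] {n : ℕ}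
    (hn : 0 < n) {q : Polynomial R} (hq : q.natDegree < n) :
    (Polynomial.X ^ n + q).Monic ∧ 0 < (Polynomial.X ^ n + q).natDegree := by
  have hd : q.degree < n :=
    lt_of_le_of_lt Polynomial.degree_le_natDegree (by exact_mod_cast hq)
  refine ⟨Polynomial.monic_X_pow_add hd, ?_⟩
  rw [Polynomial.natDegree_add_eq_left_of_natDegree_lt (by rwa [Polynomial.natDegree_X_pow]),
    Polynomial.natDegree_X_pow]
  exact hn

section Dickson

variable (p : ℕ) [Fact p.Prime]

lemma isolateVar_normZero : (isolateVar 0 (normZero p)).Monic ∧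
    0 < (isolateVar 0 (normZero p)).natDegree := by
  have hp := (Fact.out : p.Prime).one_lt
  obtain ⟨i, hi⟩ := isolateVar_X_of_ne (F := ZMod p) (n := 2) (i := 0) (j := 1) (by decide)
  obtain ⟨j, hj⟩ := isolateVar_X_of_ne (F := ZMod p) (n := 2) (i := 0) (j := 2) (by decide)
  let a : MvPolynomial (Fin 2) (ZMod p) := X j ^ (p - 1)
  let b : MvPolynomial (Fin 2) (ZMod p) := (X i ^ p - a * X i) ^ (p - 1)
  have h : isolateVar 0 (normZero p) =
      Polynomial.X ^ p ^ 2 + (- Polynomial.C (a ^ p) * Polynomial.X ^ p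
        - Polynomial.C b * (Polynomial.X ^ p - Polynomial.C a * Polynomial.X)) := by
    simp only [normZero, normOne, map_sub, map_mul, map_pow, isolateVar_X_self, hi, hj,
      sub_pow_char, a, b]
    ring
  rw [h]
  refine Polynomial.monic_X_pow_add_and_natDegree_pos (by positivity) ?_
  refine lt_of_le_of_lt (b := p) ?_ (by nlinarith)
  compute_degree
  simp [hp.le]

lemma isolateVar_normOne : (isolateVar 1 (normOne p)).Monic ∧
    0 < (isolateVar 1 (normOne p)).natDegree := by
  have hp := (Fact.out : p.Prime).one_lt
  obtain ⟨j, hj⟩ := isolateVar_X_of_ne (F := ZMod p) (n := 2) (i := 1) (j := 2) (by decide)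
  let a : MvPolynomial (Fin 2) (ZMod p) := X j ^ (p - 1)
  have h : isolateVar 1 (normOne p) =
      Polynomial.X ^ p + - (Polynomial.C a * Polynomial.X) := by
    simp only [normOne, map_sub, map_mul, map_pow, isolateVar_X_self, hj, a]
    ring
  rw [h]
  refine Polynomial.monic_X_pow_add_and_natDegree_pos (by positivity) ?_
  refine lt_of_le_of_lt (b := 1) ?_ hp
  compute_degree

/-- Monic polynomials of positive degree are closed under taking `n`-th powers and adding
constants. -/
lemma Polynomial.Monic.pow_add_C {R : Type*} [CommRing R] [Nontrivial R] {q : Polynomial R}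
    (hq : q.Monic) (hd : 0 < q.natDegree) {n : ℕ} (hn : 0 < n) (c : R) :
    (q ^ n + Polynomial.C c).Monic ∧ 0 < (q ^ n + Polynomial.C c).natDegree := by
  have h : 0 < (q ^ n).natDegree := by
    rw [hq.natDegree_pow]; positivity
  refine ⟨(hq.pow n).add_of_left ?_, ?_⟩
  · exact lt_of_le_of_lt Polynomial.degree_C_le (Polynomial.natDegree_pos_iff_degree_pos.1 h)
  · rwa [Polynomial.natDegree_add_C]

lemma isolateVar_dicksonTop : (isolateVar 0 (dicksonTop p)).Monic ∧
    0 < (isolateVar 0 (dicksonTop p)).natDegree := by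
  have hp := (Fact.out : p.Prime).one_lt
  obtain ⟨i, hi⟩ := isolateVar_X_of_ne (F := ZMod p) (n := 2) (i := 0) (j := 1) (by decide)
  obtain ⟨j, hj⟩ := isolateVar_X_of_ne (F := ZMod p) (n := 2) (i := 0) (j := 2) (by decide)
  have h : isolateVar 0 (dicksonTop p) = (isolateVar 0 (normZero p)) ^ (p - 1) + Polynomial.C
      (((X i ^ p - X j ^ (p - 1) * X i) ^ (p - 1)) ^ p + (X j ^ (p - 1)) ^ p ^ 2) := by
    simp only [dicksonTop, normOne, map_sub, map_mul, map_pow, map_add, hi, hj]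
    ring
  rw [h]
  exact (isolateVar_normZero p).1.pow_add_C (isolateVar_normZero p).2 (by omega) _

lemma isFrobeniusHom_baseHom : IsFrobeniusHom (baseHom p).toRingHom := by
  have hp := (Fact.out : p.Prime).one_lt
  let h₃ : MvPolynomial (Fin 3) (ZMod p) :=
    X 0 ^ (p - 1) + (X 1 ^ (p - 1)) ^ p + (X 2 ^ (p - 1)) ^ p ^ 2
  have h : baseHom p =
      ((substVar 0 (normZero p)).comp (substVar 1 (normOne p))).comp (substVar 0 h₃) := by
    refine MvPolynomial.algHom_ext fun i => ?_
    have e1 : substVar 0 (normZero p) (normOne p) = normOne p := by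
      simp only [normOne, map_sub, map_mul, map_pow]
      rw [substVar_X_of_ne _ (by decide), substVar_X_of_ne _ (by decide)]
    fin_cases i
    · change baseHom p (X 0) =
        substVar 0 (normZero p) (substVar 1 (normOne p) (substVar 0 h₃ (X 0)))
      rw [baseHom_X_zero, substVar_X_self]
      simp only [h₃, map_add, map_pow]
      rw [substVar_X_of_ne (i := 1) (j := 0) _ (by decide), substVar_X_self 1,
        substVar_X_of_ne (i := 1) (j := 2) _ (by decide), substVar_X_self 0,
        substVar_X_of_ne (i := 0) (j := 2) _ (by decide), e1, dicksonTop]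
    · change baseHom p (X 1) =
        substVar 0 (normZero p) (substVar 1 (normOne p) (substVar 0 h₃ (X 1)))
      rw [baseHom_X_one, substVar_X_of_ne _ (by decide), substVar_X_self, e1]
    · change baseHom p (X 2) =
        substVar 0 (normZero p) (substVar 1 (normOne p) (substVar 0 h₃ (X 2)))
      rw [baseHom_X_two, substVar_X_of_ne _ (by decide), substVar_X_of_ne _ (by decide),
        substVar_X_of_ne _ (by decide)]
  have hm₃ : (isolateVar 0 h₃).Monic ∧ 0 < (isolateVar 0 h₃).natDegree := by
    obtain ⟨i, hi⟩ := isolateVar_X_of_ne (F := ZMod p) (n := 2) (i := 0) (j := 1) (by decide)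
    obtain ⟨j, hj⟩ := isolateVar_X_of_ne (F := ZMod p) (n := 2) (i := 0) (j := 2) (by decide)
    have h : isolateVar 0 h₃ = Polynomial.X ^ (p - 1) + Polynomial.C
        ((X i ^ (p - 1)) ^ p + (X j ^ (p - 1)) ^ p ^ 2) := by
      simp only [h₃, map_pow, map_add, hi, hj, isolateVar_X_self]
      ring
    rw [h]
    exact Polynomial.monic_X.pow_add_C (by simp) (by omega) _
  rw [h]
  exact ((isFrobeniusHom_substVar 0 _ (isolateVar_normZero p).1 (isolateVar_normZero p).2).comp
    (isFrobeniusHom_substVar 1 _ (isolateVar_normOne p).1 (isolateVar_normOne p).2)).comp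
    (isFrobeniusHom_substVar 0 _ hm₃.1 hm₃.2)

lemma isFrobeniusHom_towerHom : IsFrobeniusHom (towerHom p).toRingHom := by
  have hp := (Fact.out : p.Prime).one_lt
  refine IsFrobeniusHom.comp (χ := (substVar _ _).toRingHom) (φ := (substVar _ _).toRingHom) ?_ ?_
  · obtain ⟨i, hi⟩ := isolateVar_X_of_ne (F := ZMod p) (n := 2) (i := 1) (j := 0) (by decide)
    obtain ⟨j, hj⟩ := isolateVar_X_of_ne (F := ZMod p) (n := 2) (i := 1) (j := 2) (by decide)
    let a : MvPolynomial (Fin 2) (ZMod p) := X j ^ (p - 1)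
    have h : isolateVar 1 ((X 1 ^ (p - 1)) ^ (p + 1) - (X 0 - (X 2 ^ (p - 1)) ^ p ^ 2) *
        ((X 2 ^ (p - 1)) ^ p + X 1 ^ (p - 1) : MvPolynomial (Fin 3) (ZMod p))) =
        Polynomial.X ^ ((p - 1) * (p + 1)) + - (Polynomial.C (X i - a ^ p ^ 2) *
          (Polynomial.C (a ^ p) + Polynomial.X ^ (p - 1))) := by
      simp only [map_sub, map_mul, map_pow, map_add, isolateVar_X_self, hi, hj, a]
      ring
    have := Polynomial.monic_X_pow_add_and_natDegree_pos (n := (p - 1) * (p + 1))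
      (Nat.mul_pos (by omega) (by omega))
      (q := - (Polynomial.C (X i - a ^ p ^ 2) *
          (Polynomial.C (a ^ p) + Polynomial.X ^ (p - 1)))) (by
        refine lt_of_le_of_lt (b := p - 1) ?_ ?_
        · compute_degree
        · exact lt_mul_of_one_lt_right (by omega) (by omega))
    rw [← h] at this
    exact isFrobeniusHom_substVar _ _ this.1 this.2
  · obtain ⟨i, hi⟩ := isolateVar_X_of_ne (F := ZMod p) (n := 2) (i := 2) (j := 0) (by decide)
    obtain ⟨j, hj⟩ := isolateVar_X_of_ne (F := ZMod p) (n := 2) (i := 2) (j := 1) (by decide)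
    have h : isolateVar 2 ((X 2 ^ (p - 1)) ^ (p ^ 2 + p + 1) - X 0 * (X 2 ^ (p - 1)) ^ (p + 1)
        - X 1 * X 2 ^ (p - 1) : MvPolynomial (Fin 3) (ZMod p)) =
        Polynomial.X ^ ((p - 1) * (p ^ 2 + p + 1)) + - (Polynomial.C
          (X i : MvPolynomial (Fin 2) (ZMod p)) * Polynomial.X ^ ((p - 1) * (p + 1)) +
            Polynomial.C (X j) * Polynomial.X ^ (p - 1)) := by
      simp only [map_sub, map_mul, map_pow, isolateVar_X_self, hi, hj]
      ring
    have := Polynomial.monic_X_pow_add_and_natDegree_pos (n := (p - 1) * (p ^ 2 + p + 1))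
      (Nat.mul_pos (by omega) (by omega))
      (q := - (Polynomial.C (X i : MvPolynomial (Fin 2) (ZMod p)) *
          Polynomial.X ^ ((p - 1) * (p + 1)) +
            Polynomial.C (X j) * Polynomial.X ^ (p - 1))) (by
        refine lt_of_le_of_lt (b := (p - 1) * (p + 1)) ?_ ?_
        · compute_degree
          exact max_le le_rfl (Nat.le_mul_of_pos_right _ (Nat.succ_pos p))
        · exact Nat.mul_lt_mul_of_pos_left (by nlinarith) (by omega))
    rw [← h] at this
    exact isFrobeniusHom_substVar _ _ this.1 this.2

lemma isFrobeniusHom_dicksonHom : IsFrobeniusHom (dicksonHom p).toRingHom :=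
  (isFrobeniusHom_baseHom p).comp (isFrobeniusHom_towerHom p)

end Dickson

section Character

variable {A S G : Type*} [CommRing A] [CommRing S] [Algebra A S] [Group G] [MulSemiringAction G S]
  [SMulCommClass G A S]

lemma exists_character_of_dual (Λ : S →ₗ[A] A) (hΛ : ∀ ψ : S →ₗ[A] A, ∃ s₀, ∀ s, ψ s = Λ (s₀ * s))
    (hΛ₀ : ∀ s₀, (∀ s, Λ (s₀ * s) = 0) → s₀ = 0) (hu : ∀ (g : G) (u : S), IsUnit u → g • u = u) :
    ∃ χ : G →* Sˣ, ∀ g s, Λ (g • s) = Λ ((χ g : S) * s) := by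
  have hex (g : G) : ∃ u, ∀ s, Λ (g • s) = Λ (u * s) :=
    hΛ (Λ ∘ₗ { DistribSMul.toAddMonoidHom S g with map_smul' := fun a s => smul_comm g a s })
  have heq {u v : S} (h : ∀ s, Λ (u * s) = Λ (v * s)) : u = v :=
    sub_eq_zero.mp (hΛ₀ _ fun s => by rw [sub_mul, map_sub, h, sub_self])
  choose u hu' using hex
  have hone (g : G) : u g⁻¹ * g • u g = 1 := heq fun s => by
    rw [mul_assoc, ← hu', smul_mul', inv_smul_smul, ← hu', smul_inv_smul, one_mul]
  have hunit (g : G) : IsUnit (u g) := by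
    have := hone g⁻¹
    rw [inv_inv] at this
    exact IsUnit.of_mul_eq_one _ this
  have hmul (g h : G) : u (g * h) = u g * u h := heq fun s => by
    rw [← hu', mul_smul, hu', ← hu h _ (hunit g), ← smul_mul', hu', hu h _ (hunit g)]
    congr 1; ring
  refine ⟨MonoidHom.mk' (fun g => (hunit g).unit) fun g h => Units.ext (hmul g h), hu'⟩

end Character

section SpecialLinear

variable {p : ℕ} [Fact p.Prime]

lemma character_specialLinearGroup_eq_one
    (χ : Matrix.SpecialLinearGroup (Fin 3) (ZMod p) →* (ZMod p)ˣ)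
    (g : Matrix.SpecialLinearGroup (Fin 3) (ZMod p)) : χ g = 1 := by
  have ht (i j : Fin 3) (hij : i ≠ j) (a : ZMod p) :
      χ (Matrix.SpecialLinearGroup.transvection hij a) = 1 := by
    have hn (n : ℕ) : Matrix.SpecialLinearGroup.transvection hij (n * a) =
        Matrix.SpecialLinearGroup.transvection hij a ^ n := by
      induction n with
      | zero => simp
      | succ n ih =>
        rw [Nat.cast_succ, add_mul, one_mul, Matrix.SpecialLinearGroup.transvection_add, ih,
          pow_succ]
    have hp := congrArg (fun x => ((χ x : (ZMod p)ˣ) : ZMod p)) (hn p)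
    simp only [CharP.cast_eq_zero, zero_mul, Matrix.SpecialLinearGroup.transvection_coeff_zero,
      _root_.map_one, map_pow, Units.val_pow_eq_pow_val, ZMod.pow_card] at hp
    exact Units.ext hp.symm
  refine Matrix.SpecialLinearGroup.diagonal_transvection_induction' (fun g => χ g = 1) g
    (fun i j hij c hc => ?_) ht fun A B hA hB => by rw [_root_.map_mul, hA, hB, one_mul]
  have h : Matrix.SpecialLinearGroup.diag2n hij c hc =
      Matrix.SpecialLinearGroup.transvection hij c *
      Matrix.SpecialLinearGroup.transvection hij.symm (- c⁻¹) *
      Matrix.SpecialLinearGroup.transvection hij c *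
      Matrix.SpecialLinearGroup.transvection hij (-1) *
      Matrix.SpecialLinearGroup.transvection hij.symm 1 *
      Matrix.SpecialLinearGroup.transvection hij (-1) := by
    have hji := hij.symm
    refine Subtype.ext ?_
    simp only [Matrix.SpecialLinearGroup.coe_mul, Matrix.SpecialLinearGroup.transvection_coe,
      Matrix.SpecialLinearGroup.diag2n_coe, mul_add, add_mul, mul_one, one_mul,
      Matrix.single_mul_single_same, Matrix.single_mul_single_of_ne _ _ _ _ hij,
      Matrix.single_mul_single_of_ne _ _ _ _ hji, add_zero]
    ext k l
    simp only [Matrix.add_apply, Matrix.diagonal_apply, Matrix.single_apply, Matrix.one_apply]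
    grind
  simp only [h, _root_.map_mul, ht, mul_one]

attribute [local instance] glAction

variable (p) in
/-- The ring of Dickson invariants, as an abstract polynomial ring. -/
def DicksonRing : Type := MvPolynomial (Fin 3) (ZMod p)

instance : CommRing (DicksonRing p) := inferInstanceAs (CommRing (MvPolynomial (Fin 3) (ZMod p)))

instance : IsDomain (DicksonRing p) := inferInstanceAs (IsDomain (MvPolynomial (Fin 3) (ZMod p)))

instance : UniqueFactorizationMonoid (DicksonRing p) :=
  inferInstanceAs (UniqueFactorizationMonoid (MvPolynomial (Fin 3) (ZMod p)))

instance : IsNoetherianRing (DicksonRing p) :=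
  inferInstanceAs (IsNoetherianRing (MvPolynomial (Fin 3) (ZMod p)))

instance : Algebra (DicksonRing p) (MvPolynomial (Fin 3) (ZMod p)) :=
  (dicksonHom p).toRingHom.toAlgebra

lemma isFrobeniusHom_algebraMap_dicksonRing :
    IsFrobeniusHom (algebraMap (DicksonRing p) (MvPolynomial (Fin 3) (ZMod p))) :=
  isFrobeniusHom_dicksonHom p

instance : SMulCommClass (GL (Fin 3) (ZMod p)) (DicksonRing p) (MvPolynomial (Fin 3) (ZMod p)) where
  smul_comm g a s := by
    have h : g • algebraMap (DicksonRing p) (MvPolynomial (Fin 3) (ZMod p)) a = algebraMap _ _ a :=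
      gl_smul_dicksonHom p g a
    rw [Algebra.smul_def, smul_mul', h, Algebra.smul_def]

lemma exists_invariant_dual : ∃ Λ : MvPolynomial (Fin 3) (ZMod p) →ₗ[DicksonRing p] DicksonRing p,
    (∀ (g : Matrix.SpecialLinearGroup (Fin 3) (ZMod p)) s,
      Λ (Matrix.SpecialLinearGroup.toGL g • s) = Λ s) ∧
    (∀ ψ : MvPolynomial (Fin 3) (ZMod p) →ₗ[DicksonRing p] DicksonRing p,
      ∃ s₀, ∀ s, ψ s = Λ (s₀ * s)) ∧
    ∀ s₀, (∀ s, Λ (s₀ * s) = 0) → s₀ = 0 := by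
  obtain ⟨Λ, hΛ, hΛ₀⟩ := (isFrobeniusHom_algebraMap_dicksonRing (p := p)).exists_linearMap
  have hC (u : MvPolynomial (Fin 3) (ZMod p)) (hu : IsUnit u) : u = C (constantCoeff u) := by
    obtain ⟨r, -, rfl⟩ := isUnit_iff_eq_C_of_isReduced.mp hu
    simp
  obtain ⟨χ, hχ⟩ := exists_character_of_dual (G := GL (Fin 3) (ZMod p)) Λ hΛ hΛ₀
    fun g u hu => by rw [hC u hu, gl_smul_C]
  refine ⟨Λ, fun g s => ?_, hΛ, hΛ₀⟩
  have h := character_specialLinearGroup_eq_one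
    (((Units.map (constantCoeff (R := ZMod p) (σ := Fin 3)).toMonoidHom).comp χ).comp
      Matrix.SpecialLinearGroup.toGL) g
  have h' : constantCoeff (χ (Matrix.SpecialLinearGroup.toGL g) :
    MvPolynomial (Fin 3) (ZMod p)) = 1 := congrArg Units.val h
  rw [hχ, hC _ (Units.isUnit _), h', C_1, one_mul]

end SpecialLinear

section TraceFunctions

variable (G S : Type*) [Group G] [CommRing S] [MulSemiringAction G S]

/-- The algebra of functions `G → S` generated over `S` by the orbit maps `g ↦ g • s`. -/
def orbitFunctions : Subalgebra S (G → S) :=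
  Algebra.adjoin S (Set.range fun (s : S) (g : G) => g • s)

variable {G S}

lemma smul_mem_orbitFunctions (s : S) : (fun g : G => g • s) ∈ orbitFunctions G S :=
  Algebra.subset_adjoin ⟨s, rfl⟩

lemma const_mem_orbitFunctions (s : S) : (fun _ : G => s) ∈ orbitFunctions G S :=
  (orbitFunctions G S).algebraMap_mem s

lemma dvd_sum_of_mem_orbitFunctions [Fintype G] {d : S} (hd : ∀ s : S, d ∣ ∑ g : G, g • s)
    {f : G → S} (hf : f ∈ orbitFunctions G S) : d ∣ ∑ g : G, f g := by
  rw [orbitFunctions, ← Subalgebra.mem_toSubmodule, Algebra.adjoin_eq_span] at hf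
  have hcl : Submonoid.closure (Set.range fun (s : S) (g : G) => g • s) =
      MonoidHom.mrange (MonoidHom.pi fun g : G =>
        (MulSemiringAction.toRingHom G S g).toMonoidHom) :=
    Submonoid.closure_eq (MonoidHom.mrange
      (MonoidHom.pi fun g : G => (MulSemiringAction.toRingHom G S g).toMonoidHom))
  rw [hcl] at hf
  induction hf using Submodule.span_induction with
  | mem x hx => obtain ⟨s, rfl⟩ := hx; exact hd s
  | zero => simp
  | add x y _ _ hx hy => simpa [Finset.sum_add_distrib] using dvd_add hx hy
  | smul a x _ hx => simpa [Finset.mul_sum] using hx.mul_left a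

end TraceFunctions

section Inertia

variable {G S : Type*} [Group G] [CommRing S] [MulSemiringAction G S]

variable (G) in
/-- The inertia group of an element `f` of `S`. -/
def inertia (f : S) : Subgroup G where
  carrier := {g | ∀ s : S, f ∣ g • s - s}
  one_mem' s := by simp
  mul_mem' {g h} hg hh s := by
    rw [mul_smul, ← sub_add_sub_cancel]
    exact dvd_add (hg _) (hh s)
  inv_mem' {g} hg s := by
    have := hg (g⁻¹ • s)
    rwa [smul_inv_smul, ← dvd_neg, neg_sub] at this

lemma mem_inertia {f : S} {g : G} : g ∈ inertia G f ↔ ∀ s : S, f ∣ g • s - s := Iff.rfl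

lemma inertia_eq_of_associated {f f' : S} (h : Associated f f') : inertia G f = inertia G f' :=
  Subgroup.ext fun g => by simp only [mem_inertia, h.dvd_iff_dvd_left]

lemma mul_mul_inv_mem_inertia_smul {f : S} {g h : G} (hh : h ∈ inertia G f) :
    g * h * g⁻¹ ∈ inertia G (g • f) := fun s => by
  obtain ⟨t, ht⟩ := hh (g⁻¹ • s)
  refine ⟨g • t, ?_⟩
  rw [← smul_mul', ← ht, smul_sub, smul_inv_smul, mul_smul, mul_smul]

lemma card_inertia_smul (f : S) (g : G) :
    Nat.card (inertia G (g • f)) = Nat.card (inertia G f) := by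
  refine Nat.card_congr
    { toFun := fun h => ⟨g⁻¹ * h * g, ?_⟩
      invFun := fun h => ⟨g * h * g⁻¹, mul_mul_inv_mem_inertia_smul h.2⟩
      left_inv := fun h => Subtype.ext (by group)
      right_inv := fun h => Subtype.ext (by group) }
  have := mul_mul_inv_mem_inertia_smul (g := g⁻¹) h.2
  rwa [inv_smul_smul, inv_inv] at this

lemma dvd_sum_smul_of_subgroup [Fintype G] (H : Subgroup G) [Fintype H] {d : S}
    (hd : ∀ s : S, d ∣ ∑ h : H, (h : G) • s) (s : S) : d ∣ ∑ g : G, g • s := by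
  let e : (G ⧸ H) × H → G := fun x => (x.2 : G) * x.1.out⁻¹
  have hmk (x : (G ⧸ H) × H) : ((e x)⁻¹ : G) = (x.1 : G ⧸ H) := by
    rw [_root_.mul_inv_rev, inv_inv, ← Subgroup.coe_inv,
      QuotientGroup.mk_mul_of_mem _ (SetLike.coe_mem _), QuotientGroup.out_eq']
  have he : Function.Bijective e := by
    constructor
    · intro x y h
      have h1 : x.1 = y.1 := by rw [← hmk, ← hmk, h]
      refine Prod.ext h1 (Subtype.ext ?_)
      simp only [e, h1] at h
      exact mul_right_cancel h
    · intro g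
      refine ⟨(((g⁻¹ : G) : G ⧸ H), ⟨g * ((g⁻¹ : G) : G ⧸ H).out, ?_⟩), mul_inv_cancel_right _ _⟩
      rw [← inv_inv g, ← QuotientGroup.eq, inv_inv, QuotientGroup.out_eq']
  let _ := Fintype.ofFinite (G ⧸ H)
  rw [← Fintype.sum_bijective e he (fun x => e x • s) _ fun _ => rfl, Fintype.sum_prod_type]
  refine Finset.dvd_sum fun q _ => ?_
  simp only [e, mul_smul]
  exact hd _

end Inertia

section UnipotentInertia

variable {p : ℕ} [Fact p.Prime] {G S : Type*} [Group G] [CommRing S]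
  [MulSemiringAction G S] [Algebra (ZMod p) S] [SMulCommClass G (ZMod p) S]

lemma geom_sum_eq_sub_one_pow {R : Type*} [Ring R] [Algebra (ZMod p) R] (t : R) :
    ∑ i ∈ Finset.range p, t ^ i = (t - 1) ^ (p - 1) := by
  have hp := (Fact.out : p.Prime).pos
  have h : ∑ i ∈ Finset.range p, (Polynomial.X : Polynomial (ZMod p)) ^ i =
      (Polynomial.X - 1) ^ (p - 1) := by
    have h0 : (Polynomial.X - 1 : Polynomial (ZMod p)) ≠ 0 := Polynomial.X_sub_C_ne_zero 1
    apply mul_right_cancel₀ h0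
    rw [geom_sum_mul, ← pow_succ, Nat.sub_add_cancel hp, sub_pow_char, one_pow]
  have := congrArg (Polynomial.aeval t) h
  simpa using this

lemma pow_dvd_sum_pow_smul {l : S} {g : G} (hl : g • l = l) (hg : ∀ s : S, l ∣ g • s - s) (k : ℕ)
    (s : S) (hs : l ^ k ∣ s) : l ^ (k + (p - 1)) ∣ ∑ i ∈ Finset.range p, g ^ i • s := by
  let T : S →ₗ[ZMod p] S := DistribSMul.toLinearMap (ZMod p) S g
  have hT (i : ℕ) (s : S) : (T ^ i) s = g ^ i • s := by
    induction i with
    | zero => simp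
    | succ i ih => rw [pow_succ', Module.End.mul_apply, ih, pow_succ', mul_smul]; rfl
  have hT1 (n : ℕ) : l ^ (k + n) ∣ ((T - 1) ^ n) s := by
    induction n with
    | zero => exact hs
    | succ n ih =>
      obtain ⟨t, ht⟩ := ih
      rw [pow_succ', Module.End.mul_apply, ht]
      change _ ∣ g • (l ^ (k + n) * t) - l ^ (k + n) * t
      rw [smul_mul', smul_pow', hl, ← mul_sub, ← add_assoc, pow_succ]
      exact mul_dvd_mul_left _ (hg t)
  have h := congrArg (fun f : Module.End (ZMod p) S => f s) (geom_sum_eq_sub_one_pow (p := p) T)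
  simp only [LinearMap.sum_apply, hT] at h
  rw [h]
  exact hT1 _

lemma unipotent_inertia [IsDomain S] (l : S) (V : Set S) (H : Subgroup G) [Finite H]
    (hl : ∀ h ∈ H, h • l = l) (hI : H ≤ inertia G l)
    (hV : ∀ h ∈ H, ∀ v ∈ V, ∃ c : ZMod p, h • v = v + c • l)
    (hf : ∀ h ∈ H, (∀ v ∈ V, h • v = v) → h = 1) :
    ∃ m, Nat.card H = p ^ m ∧
      (∀ [Fintype H] (s : S), l ^ (m * (p - 1)) ∣ ∑ h : H, (h : G) • s) ∧
      ∃ P ∈ orbitFunctions G S, (∃ u, IsUnit u ∧ P 1 = u * l ^ (m * (p - 1))) ∧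
        ∀ h ∈ H, h ≠ 1 → P h = 0 := by
  induction hn : Nat.card H using Nat.strong_induction_on generalizing H with
  | _ n ih =>
  by_cases hH : H = ⊥
  · subst hH
    refine ⟨0, by simpa using hn.symm, by simp, 1, one_mem _, ⟨1, isUnit_one, by simp⟩, ?_⟩
    intro h hh h1
    exact absurd (Subgroup.mem_bot.mp hh) h1
  obtain ⟨h₀, hh₀, hh₀1⟩ := H.bot_or_exists_ne_one.resolve_left hH
  obtain ⟨v, hv, hv₀⟩ : ∃ v ∈ V, h₀ • v ≠ v := by
    by_contra! hc
    exact hh₀1 (hf h₀ hh₀ hc)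
  have hp := (Fact.out : p.Prime)
  have hex (h : H) : ∃ c : ZMod p, (h : G) • v = v + c • l := hV h h.2 v hv
  choose c hc using hex
  have hl0 : l ≠ 0 := by
    rintro rfl
    exact hv₀ (by simpa using hc ⟨h₀, hh₀⟩)
  have hcinj {a b : ZMod p} (h : v + a • l = v + b • l) : a = b :=
    smul_left_injective (ZMod p) hl0 (add_left_cancel h)
  have hcmul (g h : H) : c (g * h) = c g + c h := hcinj (by
    rw [← hc, Subgroup.coe_mul, mul_smul, hc h, smul_add, hc g, smul_comm, hl g g.2, add_smul,
      add_assoc])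
  have hc1 : c 1 = 0 := hcinj (by rw [← hc]; simp)
  have hcpow (g : H) (n : ℕ) : c (g ^ n) = n * c g := by
    induction n with
    | zero => simp [hc1]
    | succ n ih => rw [pow_succ, hcmul, ih]; push_cast; ring
  have hc₀ : c ⟨h₀, hh₀⟩ ≠ 0 := fun h => hv₀ (by
    have := hc ⟨h₀, hh₀⟩; rwa [h, zero_smul, add_zero] at this)
  obtain ⟨g, hg⟩ : ∃ g : H, c g = 1 := ⟨⟨h₀, hh₀⟩ ^ (c ⟨h₀, hh₀⟩)⁻¹.val, by
    rw [hcpow, ZMod.natCast_zmod_val, inv_mul_cancel₀ hc₀]⟩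
  let K : Subgroup G := H ⊓ MulAction.stabilizer G v
  have hKH : K ≤ H := inf_le_left
  have hKc (h : H) : (h : G) ∈ K ↔ c h = 0 := by
    rw [Subgroup.mem_inf, MulAction.mem_stabilizer_iff, hc, and_iff_right h.2, add_eq_left,
      smul_eq_zero, or_iff_left hl0]
  have : Finite K := Finite.of_injective _ (Subgroup.inclusion_injective hKH)
  let _ := Fintype.ofFinite H
  let _ := Fintype.ofFinite K
  let e : Fin p × K → H := fun x => g ^ (x.1 : ℕ) * ⟨x.2, hKH x.2.2⟩
  have hce (x : Fin p × K) : c (e x) = (x.1 : ℕ) := by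
    rw [hcmul, hcpow, hg, (hKc ⟨x.2, hKH x.2.2⟩).mp x.2.2, mul_one, add_zero]
  have he : Function.Bijective e := by
    constructor
    · rintro ⟨i, k⟩ ⟨j, k'⟩ h
      have h1 := congrArg c h
      rw [hce, hce] at h1
      have hij : i = j := Fin.ext (by
        have := (ZMod.natCast_eq_natCast_iff' _ _ p).mp h1
        rwa [Nat.mod_eq_of_lt i.2, Nat.mod_eq_of_lt j.2] at this)
      subst hij
      have h2 := mul_left_cancel h
      exact Prod.ext rfl (Subtype.ext (congrArg (fun x : H => (x : G)) h2))
    · intro h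
      have hk : c ((g ^ (c h).val)⁻¹ * h) = 0 := by
        have := hcmul (g ^ (c h).val) ((g ^ (c h).val)⁻¹ * h)
        rw [mul_inv_cancel_left, hcpow, hg, mul_one, ZMod.natCast_zmod_val] at this
        exact left_eq_add.mp this
      refine ⟨⟨⟨(c h).val, ZMod.val_lt _⟩, ⟨_, (hKc _).mpr hk⟩⟩, ?_⟩
      exact mul_inv_cancel_left _ _
  have hcard : Nat.card H = p * Nat.card K := by
    rw [← Nat.card_congr (Equiv.ofBijective e he), Nat.card_prod, Nat.card_fin]
  have hKpos : 0 < Nat.card K := Nat.card_pos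
  obtain ⟨m, hm, hD, P, hP, ⟨u, hu, hP1⟩, hP0⟩ := ih (Nat.card K)
    (by rw [← hn, hcard]; exact lt_mul_of_one_lt_left hKpos hp.one_lt) K
    (fun h hh => hl h (hKH hh)) (hKH.trans hI) (fun h hh => hV h (hKH hh))
    (fun h hh => hf h (hKH hh)) rfl
  refine ⟨m + 1, by rw [← hn, hcard, hm, pow_succ'], ?_, ?_⟩
  · intro inst s
    have : ∑ h : H, (h : G) • s = ∑ i ∈ Finset.range p, (g : G) ^ i • ∑ k : K, (k : G) • s := by
      rw [Finset.sum_range, ← Fintype.sum_bijective e he (fun x => (e x : G) • s) _ fun _ => rfl,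
        Fintype.sum_prod_type]
      refine Finset.sum_congr rfl fun i _ => ?_
      rw [Finset.smul_sum]
      refine Finset.sum_congr rfl fun k _ => ?_
      rw [← mul_smul]
      rfl
    rw [this, add_mul, one_mul]
    exact pow_dvd_sum_pow_smul (hl g g.2) (hI g.2) _ _ (hD s)
  · refine ⟨P * ∏ a : (ZMod p)ˣ, ((fun _ => v) - (fun g => g • v) + fun _ => (a : ZMod p) • l),
      mul_mem hP (prod_mem fun a _ => add_mem (sub_mem (const_mem_orbitFunctions _)
        (smul_mem_orbitFunctions _)) (const_mem_orbitFunctions _)), ?_, ?_⟩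
    · refine ⟨u * algebraMap (ZMod p) S ((∏ a : (ZMod p)ˣ, a : (ZMod p)ˣ) : ZMod p),
        hu.mul ((Units.isUnit _).map _), ?_⟩
      rw [Pi.mul_apply, hP1, Finset.prod_apply]
      simp only [Pi.add_apply, Pi.sub_apply, one_smul, sub_self, zero_add, Algebra.smul_def]
      rw [Finset.prod_mul_distrib, Finset.prod_const, Finset.card_univ, ZMod.card_units,
        Units.coe_prod, map_prod]
      ring
    · intro h hh h1
      rw [Pi.mul_apply]
      by_cases hk : h ∈ K
      · rw [hP0 h hk h1, zero_mul]
      · have hch : c ⟨h, hh⟩ ≠ 0 := fun h0 => hk ((hKc ⟨h, hh⟩).mpr h0)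
        rw [Finset.prod_apply, Finset.prod_eq_zero (Finset.mem_univ (Units.mk0 _ hch)), mul_zero]
        have := hc ⟨h, hh⟩
        simp only at this
        simp [this]

end UnipotentInertia

section LocalTrace

variable {G S : Type*} [Group G] [CommRing S] [IsDomain S] [MulSemiringAction G S]

lemma exists_not_pow_succ_dvd_sum [Fintype G] {f : S} (hf : Prime f) {k : ℕ} {P : G → S}
    (hP : P ∈ orbitFunctions G S) (hP1 : ∃ u, IsUnit u ∧ P 1 = u * f ^ k)
    (hP0 : ∀ h ∈ inertia G f, h ≠ 1 → P h = 0) : ∃ s : S, ¬ f ^ (k + 1) ∣ ∑ g : G, g • s := by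
  classical
  by_contra! hall
  obtain ⟨u, hu, hP1⟩ := hP1
  have hex (g : G) : ∃ s : S, g ∉ inertia G f → ¬ f ∣ g • s - s := by
    by_cases hg : g ∈ inertia G f
    · exact ⟨0, fun h => absurd hg h⟩
    · rw [mem_inertia, not_forall] at hg
      exact hg.imp fun s hs _ => hs
  choose t ht using hex
  let T : Finset G := Finset.univ.filter (· ∉ inertia G f)
  let Q : G → S := P * ∏ g ∈ T, ((fun _ => g • t g) - fun h => h • t g)
  have hQ : Q ∈ orbitFunctions G S := mul_mem hP (prod_mem fun g _ =>
    sub_mem (const_mem_orbitFunctions _) (smul_mem_orbitFunctions _))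
  have hQdef (h : G) : Q h = P h * ∏ g ∈ T, (g • t g - h • t g) := by
    simp [Q, Finset.prod_apply]
  have hQ0 (h : G) (h1 : h ≠ 1) : Q h = 0 := by
    by_cases hh : h ∈ inertia G f
    · rw [hQdef, hP0 h hh h1, zero_mul]
    · rw [hQdef, Finset.prod_eq_zero (i := h) (by simp [T, hh]) (by simp),
        mul_zero]
  have hdvd := dvd_sum_of_mem_orbitFunctions hall hQ
  rw [Fintype.sum_eq_single 1 hQ0, hQdef, hP1, pow_succ,
    mul_comm u, mul_assoc, mul_dvd_mul_iff_left (pow_ne_zero _ hf.ne_zero), hu.dvd_mul_left,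
    hf.dvd_finsetProd_iff] at hdvd
  obtain ⟨g, hg, hfg⟩ := hdvd
  simp only [one_smul] at hfg
  exact ht g (by simpa [T] using hg) hfg

end LocalTrace

section LinearForms

variable {F : Type u} [Field F] {n : ℕ}

lemma constantCoeff_linearForm (v : Fin n → F) : constantCoeff (linearForm v) = 0 := by
  simp [linearForm]

lemma totalDegree_linearForm {v : Fin n → F} (hv : v ≠ 0) : (linearForm v).totalDegree = 1 := by
  apply le_antisymm
  · refine (totalDegree_finsetSum_le fun i _ => ?_)
    exact (totalDegree_smul_le _ _).trans (totalDegree_X _).le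
  · by_contra! h
    have h0 := totalDegree_eq_zero_iff_eq_C.mp (Nat.lt_one_iff.mp h)
    have : coeff 0 (linearForm v) = 0 := constantCoeff_linearForm v
    rw [this, C_0] at h0
    exact hv (linearForm_eq_zero.mp h0)

lemma prime_linearForm {v : Fin n → F} (hv : v ≠ 0) : Prime (linearForm v) := by
  rw [← irreducible_iff_prime]
  refine irreducible_of_totalDegree_eq_one (totalDegree_linearForm hv) fun x hx => ?_
  obtain ⟨i, hi⟩ := Function.ne_iff.mp hv
  have := hx (Finsupp.single i 1)
  rw [coeff_linearForm] at this
  exact (ne_zero_of_dvd_ne_zero hi this).isUnit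

lemma exists_eq_smul_of_linearForm_dvd {v w : Fin n → F} (h : linearForm v ∣ linearForm w) :
    ∃ c : F, w = c • v := by
  obtain ⟨q, hq⟩ := h
  by_cases hw : w = 0
  · exact ⟨0, by rw [hw, zero_smul]⟩
  have hw' : linearForm w ≠ 0 := fun h => hw (linearForm_eq_zero.mp h)
  have hv' : linearForm v ≠ 0 := fun h => hw' (by rw [hq, h, zero_mul])
  have hq' : q ≠ 0 := fun h => hw' (by rw [hq, h, mul_zero])
  have hd := totalDegree_mul_of_isDomain hv' hq'
  rw [← hq, totalDegree_linearForm hw,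
    totalDegree_linearForm fun h => hv' (linearForm_eq_zero.mpr h),
    left_eq_add, totalDegree_eq_zero_iff_eq_C] at hd
  refine ⟨coeff 0 q, linearForm_injective ?_⟩
  rw [hq, hd, linearForm_smul, smul_eq_C_mul, mul_comm]
  simp

attribute [local instance] glAction

instance : SMulCommClass (GL (Fin n) F) F (MvPolynomial (Fin n) F) := ⟨gl_smul_smul⟩

lemma gl_eq_one_of_forall_smul_linearForm {g : GL (Fin n) F}
    (h : ∀ v : Fin n → F, g • linearForm v = linearForm v) : g = 1 := by
  rw [← inv_eq_one]
  refine Units.ext (Matrix.ext_iff_vecMul.mpr fun v => ?_)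
  rw [Units.val_one, Matrix.vecMul_one]
  have := h v
  rw [gl_smul_linearForm] at this
  exact linearForm_injective this

lemma exists_smul_linearForm_of_mem_inertia {v : Fin n → F} {g : GL (Fin n) F}
    (hg : g ∈ inertia (GL (Fin n) F) (linearForm v)) (w : Fin n → F) :
    ∃ c : F, g • linearForm w = linearForm w + c • linearForm v := by
  have h := hg (linearForm w)
  rw [gl_smul_linearForm, sub_eq_add_neg, ← neg_one_smul F (linearForm w), ← linearForm_smul,
    ← linearForm_add] at h
  obtain ⟨c, hc⟩ := exists_eq_smul_of_linearForm_dvd h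
  refine ⟨c, ?_⟩
  rw [← linearForm_smul, ← hc, ← linearForm_add, gl_smul_linearForm]
  simp

lemma smul_linearForm_of_mem_inertia {v : Fin n → F} {g : GL (Fin n) F}
    (hg : g ∈ inertia (GL (Fin n) F) (linearForm v)) (hdet : g.1.det = 1) :
    g • linearForm v = linearForm v := by
  choose φ hφ using fun i : Fin n => exists_smul_linearForm_of_mem_inertia hg (Pi.single i 1)
  have hM : (g⁻¹ : GL (Fin n) F).1 = 1 + replicateCol Unit φ * replicateRow Unit v := by
    ext i j
    have h := hφ i
    rw [gl_smul_linearForm, ← linearForm_smul, ← linearForm_add] at h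
    have := congrFun (linearForm_injective h) j
    simpa [Matrix.one_apply, Pi.single_apply, eq_comm, Matrix.mul_apply] using this
  have hd : (g⁻¹ : GL (Fin n) F).1.det = 1 := by
    have : (g.1 * (g⁻¹ : GL (Fin n) F).1).det = 1 := by rw [Units.mul_inv, Matrix.det_one]
    rwa [Matrix.det_mul, hdet, one_mul] at this
  rw [hM, Matrix.det_one_add_replicateCol_mul_replicateRow, add_eq_left] at hd
  rw [gl_smul_linearForm, hM, Matrix.vecMul_add, Matrix.vecMul_one]
  congr 1
  rw [← Matrix.vecMul_vecMul]
  have : v ᵥ* replicateCol Unit φ = 0 := funext fun _ => hd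
  rw [this, Matrix.zero_vecMul, add_zero]

end LinearForms

section Different

variable {p : ℕ} [Fact p.Prime] {n : ℕ} (Γ : Subgroup (GL (Fin n) (ZMod p)))

attribute [local instance] glAction

/-- The exponent of the linear form with coefficient vector `v` in the different: the base `p`
logarithm of the order of the inertia group. -/
def inertiaLog (v : Fin n → ZMod p) : ℕ := Nat.log p (Nat.card (inertia Γ (linearForm v)))

/-- The product of all linear forms, with multiplicities given by the inertia groups. -/
def differentElement : MvPolynomial (Fin n) (ZMod p) :=
  ∏ v : Fin n → ZMod p, linearForm v ^ inertiaLog Γ v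

lemma inertia_linearForm_zero : inertia Γ (linearForm (0 : Fin n → ZMod p)) = ⊥ := by
  rw [eq_bot_iff]
  intro g hg
  refine Subtype.ext (gl_eq_one_of_forall_smul_linearForm fun v => ?_)
  have := hg (linearForm v)
  rw [linearForm_eq_zero.mpr rfl, zero_dvd_iff, sub_eq_zero] at this
  exact this

lemma inertiaLog_zero : inertiaLog Γ 0 = 0 := by
  rw [inertiaLog, inertia_linearForm_zero]; simp

lemma differentElement_ne_zero : differentElement Γ ≠ 0 := by
  refine Finset.prod_ne_zero_iff.mpr fun v _ => ?_
  by_cases hv : v = 0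
  · rw [hv, inertiaLog_zero, pow_zero]; exact one_ne_zero
  · exact pow_ne_zero _ fun h => hv (linearForm_eq_zero.mp h)

lemma smul_differentElement (g : Γ) : g • differentElement Γ = differentElement Γ := by
  let e : (Fin n → ZMod p) ≃ (Fin n → ZMod p) :=
    { toFun := fun v => v ᵥ* ((g : GL (Fin n) (ZMod p))⁻¹).1
      invFun := fun v => v ᵥ* (g : GL (Fin n) (ZMod p)).1
      left_inv := fun v => by simp [Matrix.vecMul_vecMul]
      right_inv := fun v => by simp [Matrix.vecMul_vecMul] }
  have he (v : Fin n → ZMod p) : g • linearForm v = linearForm (e v) :=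
    gl_smul_linearForm (g : GL (Fin n) (ZMod p)) v
  rw [differentElement, Finset.smul_prod', ← e.prod_comp (fun v => linearForm v ^ inertiaLog Γ v)]
  refine Finset.prod_congr rfl fun v _ => ?_
  rw [smul_pow', he, inertiaLog, inertiaLog, ← he, card_inertia_smul]

variable {Γ}

lemma exists_associated_linearForm_of_inertia_ne_bot {f : MvPolynomial (Fin n) (ZMod p)}
    (hf : Prime f) (h : inertia Γ f ≠ ⊥) :
    ∃ v : Fin n → ZMod p, v ≠ 0 ∧ Associated f (linearForm v) := by
  obtain ⟨⟨g, hg⟩, hg1⟩ := Subgroup.ne_bot_iff_exists_ne_one.mp h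
  obtain ⟨w, hw⟩ : ∃ w : Fin n → ZMod p,
      (g : GL (Fin n) (ZMod p)) • linearForm w ≠ linearForm w := by
    by_contra! hw
    exact hg1 (Subtype.ext (Subtype.ext (gl_eq_one_of_forall_smul_linearForm hw)))
  have hd : f ∣ (g : GL (Fin n) (ZMod p)) • linearForm w - linearForm w := hg (linearForm w)
  have he : (g : GL (Fin n) (ZMod p)) • linearForm w - linearForm w =
      linearForm (w ᵥ* ((g : GL (Fin n) (ZMod p))⁻¹).1 + (-1 : ZMod p) • w) := by
    rw [gl_smul_linearForm, linearForm_add, linearForm_smul, neg_one_smul, sub_eq_add_neg]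
  have hv : w ᵥ* ((g : GL (Fin n) (ZMod p))⁻¹).1 + (-1 : ZMod p) • w ≠ 0 := fun h0 =>
    hw (sub_eq_zero.mp (he.trans (linearForm_eq_zero.mpr h0)))
  exact ⟨_, hv, hf.associated_of_dvd (prime_linearForm hv) (he ▸ hd)⟩

/-- The order of the transfer ideal and of the different at a prime `f` agree. -/
def HasDifferentExponent [Fintype Γ] (f : MvPolynomial (Fin n) (ZMod p)) : Prop :=
  ∃ k δ, differentElement Γ = f ^ k * δ ∧ ¬ f ∣ δ ∧ (∀ s, f ^ k ∣ ∑ g : Γ, g • s) ∧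
    ∃ s : MvPolynomial (Fin n) (ZMod p), ¬ f ^ (k + 1) ∣ ∑ g : Γ, g • s

lemma hasDifferentExponent_linearForm [Fintype Γ] (hdet : ∀ g ∈ Γ, g.1.det = 1)
    {v : Fin n → ZMod p} (hv : v ≠ 0) : HasDifferentExponent (Γ := Γ) (linearForm v) := by
  classical
  have hp := prime_linearForm hv
  have hmem {h : Γ} (hh : h ∈ inertia Γ (linearForm v)) :
      (h : GL (Fin n) (ZMod p)) ∈ inertia (GL (Fin n) (ZMod p)) (linearForm v) := hh
  obtain ⟨m, hm, hdvd, P, hP, hP1, hP0⟩ := unipotent_inertia (p := p) (G := Γ) (linearForm v)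
    (Set.range (linearForm (F := ZMod p))) (inertia Γ (linearForm v))
    (fun h hh => smul_linearForm_of_mem_inertia (hmem hh) (hdet h h.2)) le_rfl
    (by
      rintro h hh _ ⟨w, rfl⟩
      exact exists_smul_linearForm_of_mem_inertia (hmem hh) w)
    (fun h _ hV => Subtype.ext (gl_eq_one_of_forall_smul_linearForm fun w => hV _ ⟨w, rfl⟩))
  have hlog {w : Fin n → ZMod p} (hw : Associated (linearForm w) (linearForm v)) :
      inertiaLog Γ w = m := by
    rw [inertiaLog, inertia_eq_of_associated hw, hm, Nat.log_pow (Fact.out : p.Prime).one_lt]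
  let T : Finset (Fin n → ZMod p) := Finset.univ.image fun c : (ZMod p)ˣ => c • v
  have hT {w : Fin n → ZMod p} (hw : w ∈ T) : Associated (linearForm w) (linearForm v) := by
    obtain ⟨c, -, rfl⟩ := Finset.mem_image.mp hw
    rw [Units.smul_def, linearForm_smul, smul_eq_C_mul]
    exact associated_unit_mul_left _ _ (c.isUnit.map C)
  have hTcard : T.card = p - 1 := by
    rw [Finset.card_image_of_injective, Finset.card_univ, ZMod.card_units]
    intro c d h
    exact Units.ext (smul_left_injective (ZMod p) hv h)
  have hTprod : Associated (linearForm v ^ (m * (p - 1)))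
      (∏ w ∈ T, linearForm w ^ inertiaLog Γ w) := by
    rw [pow_mul, ← hTcard, ← Finset.prod_const]
    refine Associated.prod _ _ _ fun w hw => ?_
    rw [hlog (hT hw)]
    exact (hT hw).symm.pow_pow
  obtain ⟨u, hu⟩ := hTprod
  refine ⟨m * (p - 1), u * ∏ w ∈ Tᶜ, linearForm w ^ inertiaLog Γ w, ?_, ?_, fun s => ?_, ?_⟩
  · rw [← mul_assoc, hu, Finset.prod_mul_prod_compl, differentElement]
  · rw [Units.dvd_mul_left, hp.dvd_finsetProd_iff]
    rintro ⟨w, hw, hvw⟩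
    by_cases hw0 : w = 0
    · rw [hw0, inertiaLog_zero, pow_zero] at hvw
      exact hp.not_dvd_one hvw
    obtain ⟨c, rfl⟩ := exists_eq_smul_of_linearForm_dvd (hp.dvd_of_dvd_pow hvw)
    have hc : c ≠ 0 := fun h => hw0 (by rw [h, zero_smul])
    exact Finset.mem_compl.mp hw (Finset.mem_image.mpr ⟨Units.mk0 c hc, Finset.mem_univ _, rfl⟩)
  · exact dvd_sum_smul_of_subgroup _ (fun s => hdvd s) s
  · exact exists_not_pow_succ_dvd_sum hp hP hP1 hP0

lemma hasDifferentExponent [Fintype Γ] (hdet : ∀ g ∈ Γ, g.1.det = 1)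
    {f : MvPolynomial (Fin n) (ZMod p)} (hf : Prime f) : HasDifferentExponent (Γ := Γ) f := by
  by_cases hlin : ∃ v : Fin n → ZMod p, v ≠ 0 ∧ Associated f (linearForm v)
  · obtain ⟨v, hv, u, hu⟩ := hlin
    obtain ⟨k, δ, h1, h2, h3, h4⟩ := hasDifferentExponent_linearForm hdet hv
    rw [← hu] at h1 h2 h3 h4
    refine ⟨k, u ^ k * δ, ?_, ?_, fun s => ?_, h4.imp fun s hs hd => hs ?_⟩
    · rw [h1]; ring
    · rw [← Units.val_pow_eq_pow_val, Units.dvd_mul_left]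
      rwa [Units.mul_right_dvd] at h2
    · exact (pow_dvd_pow_of_dvd (dvd_mul_right _ _) _).trans (h3 s)
    · rw [mul_pow, ← Units.val_pow_eq_pow_val, Units.mul_right_dvd]
      exact hd
  · have hbot : inertia Γ f = ⊥ := by
      by_contra h
      exact hlin (exists_associated_linearForm_of_inertia_ne_bot hf h)
    refine ⟨0, differentElement Γ, by simp, ?_, by simp,
      exists_not_pow_succ_dvd_sum hf (one_mem _) ⟨1, isUnit_one, by simp⟩ ?_⟩
    · rw [differentElement, hf.dvd_finsetProd_iff]
      rintro ⟨w, -, hw⟩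
      by_cases hw0 : w = 0
      · rw [hw0, inertiaLog_zero, pow_zero] at hw
        exact hf.not_dvd_one hw
      exact hlin ⟨w, hw0, hf.associated_of_dvd (prime_linearForm hw0) (hf.dvd_of_dvd_pow hw)⟩
    · intro h hh h1
      rw [hbot] at hh
      exact absurd hh h1

lemma differentElement_dvd_sum_smul [Fintype Γ] (hdet : ∀ g ∈ Γ, g.1.det = 1)
    (s : MvPolynomial (Fin n) (ZMod p)) : differentElement Γ ∣ ∑ g : Γ, g • s := by
  refine dvd_of_forall_prime_exists _ (differentElement_ne_zero Γ) _ fun q hq => ?_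
  obtain ⟨k, δ, h1, h2, h3, -⟩ := hasDifferentExponent hdet hq
  obtain ⟨b, hb⟩ := h3 s
  refine ⟨δ, b, ?_, h2⟩
  rw [h1, hb]; ring

lemma exists_not_mul_differentElement_dvd [Fintype Γ] (hdet : ∀ g ∈ Γ, g.1.det = 1)
    {f : MvPolynomial (Fin n) (ZMod p)} (hf : Prime f) :
    ∃ s : MvPolynomial (Fin n) (ZMod p), ¬ f * differentElement Γ ∣ ∑ g : Γ, g • s := by
  obtain ⟨k, δ, h1, -, -, h4⟩ := hasDifferentExponent hdet hf
  refine h4.imp fun s hs hd => hs (Dvd.dvd.trans ⟨δ, ?_⟩ hd)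
  rw [h1]; ring

end Different

open scoped TensorProduct in
lemma exists_sum_X_pow_tmul {B M : Type*} [CommRing B] [AddCommGroup M] [Module B M]
    (t : Polynomial B ⊗[B] M) : ∃ (n : ℕ) (m : ℕ → M), (∀ i, n ≤ i → m i = 0) ∧
      t = ∑ i ∈ Finset.range n, (Polynomial.X ^ i : Polynomial B) ⊗ₜ[B] m i := by
  induction t using tensor_induction_X_pow with
  | hadd s t hs ht =>
    obtain ⟨n, m, hm, rfl⟩ := hs
    obtain ⟨n', m', hm', rfl⟩ := ht
    have hext {k l : ℕ} {a : ℕ → M} (ha : ∀ i, k ≤ i → a i = 0) (hkl : k ≤ l) :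
        ∑ i ∈ Finset.range k, (Polynomial.X ^ i : Polynomial B) ⊗ₜ[B] a i =
          ∑ i ∈ Finset.range l, (Polynomial.X ^ i : Polynomial B) ⊗ₜ[B] a i := by
      refine Finset.sum_subset (Finset.range_mono hkl) fun i _ hi => ?_
      rw [ha i (by simpa using hi), TensorProduct.tmul_zero]
    refine ⟨max n n', m + m', fun i hi => ?_, ?_⟩
    · rw [Pi.add_apply, hm i (le_of_max_le_left hi), hm' i (le_of_max_le_right hi), add_zero]
    · rw [hext hm (le_max_left n n'), hext hm' (le_max_right n n'), ← Finset.sum_add_distrib]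
      simp only [Pi.add_apply, TensorProduct.tmul_add]
  | hX k m =>
    classical
    refine ⟨k + 1, Pi.single k m, fun i hi => Pi.single_eq_of_ne (by omega) _, ?_⟩
    rw [Finset.sum_eq_single_of_mem k (by simp), Pi.single_eq_same]
    intro i _ hi
    rw [Pi.single_eq_of_ne hi, TensorProduct.tmul_zero]

lemma projective_pi_of_finite {B P ι : Type*} [CommRing B] [AddCommGroup P] [Module B P]
    [Module.Projective B P] [Finite ι] : Module.Projective B (ι → P) := by
  classical
  have : Module.Projective B (ι →₀ P) := Module.Projective.of_equiv (finsuppLequivDFinsupp B).symm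
  exact Module.Projective.of_equiv (Finsupp.linearEquivFunOnFinite B P ι)

theorem projective_polynomial_of_invariants {B D : Type u} [CommRing B]
    (hB : ∀ M : ModuleCat.{u} B, HasProjectiveDimensionLE M 2) [CommRing D] [Nontrivial D]
    [Algebra B D] [Module.Projective B D] {N : Polynomial D} (hN : N.Monic) (hd : 0 < N.natDegree)
    {ι : Type u} [Finite ι] (τ : ι → Polynomial D →ₗ[B] Polynomial D)
    (hτN : ∀ i s, τ i (N * s) = N * τ i s)
    (hτd : ∀ i s, s.degree < N.degree → (τ i s).degree < N.degree)
    {M : Type u} [AddCommGroup M] [Module (Polynomial B) M] (j : M →+ Polynomial D)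
    (hj : Function.Injective j) (hrange : ∀ s, (∃ m, j m = s) ↔ ∀ i, τ i s = s)
    (hjC : ∀ (b : B) m, j (Polynomial.C b • m) = b • j m)
    (hjX : ∀ m, j ((Polynomial.X : Polynomial B) • m) = N * j m) :
    Module.Projective (Polynomial B) M := by
  let d := N.natDegree
  have hmem (s : Polynomial D) : s ∈ Polynomial.degreeLT D d ↔ s.degree < N.degree := by
    rw [Polynomial.mem_degreeLT, Polynomial.degree_eq_natDegree hN.ne_zero]
  have hpow (k : ℕ) (m : M) : j ((Polynomial.X ^ k : Polynomial B) • m) = N ^ k * j m := by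
    induction k with
    | zero => simp
    | succ k ih => rw [pow_succ', mul_smul, hjX, ih, pow_succ', mul_assoc]
  let f : Polynomial.degreeLT D d →ₗ[B] (ι → Polynomial D) :=
    LinearMap.pi fun i => (τ i - LinearMap.id) ∘ₗ
      ((Polynomial.degreeLT D d).subtype.restrictScalars B)
  have : Module.Projective B (Fin d → D) := projective_pi_of_finite
  have : Module.Projective B (Polynomial.degreeLT D d) :=
    Module.Projective.of_equiv ((Polynomial.degreeLTEquiv D d).restrictScalars B).symm
  have : Module.Projective B (Polynomial D) := projective_restrictScalars B D (Polynomial D)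
  have : Module.Projective B (ι → Polynomial D) := projective_pi_of_finite
  have hM' := projective_ker_of_forall_hasProjectiveDimensionLE_two hB f
  have hker (x : LinearMap.ker f) (i : ι) : τ i (x.1 : Polynomial D) = x.1 :=
    sub_eq_zero.mp (congrFun (LinearMap.mem_ker.mp x.2) i)
  choose k hk using fun x : LinearMap.ker f => (hrange (x.1 : Polynomial D)).mpr (hker x)
  let _ : Module B M := Module.compHom M (Polynomial.C : B →+* Polynomial B)
  have : IsScalarTower B (Polynomial B) M := IsScalarTower.of_algebraMap_smul fun _ _ => rfl
  let κ : LinearMap.ker f →ₗ[B] M :=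
    { toFun := k
      map_add' := fun x y => hj (by rw [map_add, hk, hk, hk]; rfl)
      map_smul' := fun b x => hj (by
        refine Eq.trans ?_ (hjC b (k x)).symm
        rw [hk, hk]; rfl) }
  let Φ := LinearMap.liftBaseChange (Polynomial B) κ
  have hΦ (i : ℕ) (x : LinearMap.ker f) :
      j (Φ ((Polynomial.X ^ i : Polynomial B) ⊗ₜ x)) = N ^ i * x.1 := by
    rw [LinearMap.liftBaseChange_tmul, hpow]
    exact congrArg _ (hk x)
  have hinj : Function.Injective Φ := by
    rw [injective_iff_map_eq_zero]
    intro t ht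
    obtain ⟨n, m, -, rfl⟩ := exists_sum_X_pow_tmul (B := B) (M := LinearMap.ker f) t
    have h0 : ∑ i ∈ Finset.range n, N ^ i * ((m i).1 : Polynomial D) = 0 := by
      simp only [← hΦ]
      rw [← map_sum, ← map_sum, ht, map_zero]
    have := hN.eq_zero_of_sum_pow_mul_eq_zero n (fun i => ((m i).1 : Polynomial D))
      (fun i => (hmem _).mp (m i).1.2) h0
    refine Finset.sum_eq_zero fun i hi => ?_
    rw [show m i = 0 from Subtype.ext (Subtype.ext (this i (Finset.mem_range.mp hi))),
      TensorProduct.tmul_zero]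
  have hsurj (s : Polynomial D) : (∀ i, τ i s = s) → ∃ t, j (Φ t) = s := by
    induction s using hN.induction_divByMonic hd with
    | h0 => exact fun _ => ⟨0, by simp⟩
    | h s ih =>
      intro hs
      have hdiv := Polynomial.modByMonic_add_div s N
      have hτ (i : ι) := Polynomial.div_modByMonic_unique (f := s) (τ i (s /ₘ N)) (τ i (s %ₘ N)) hN
        ⟨by rw [← hτN, ← map_add, hdiv, hs], hτd i _ (Polynomial.degree_modByMonic_lt s hN)⟩
      obtain ⟨t, ht⟩ := ih fun i => (hτ i).1.symm
      let x : LinearMap.ker f := ⟨⟨s %ₘ N, (hmem _).mpr (Polynomial.degree_modByMonic_lt s hN)⟩,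
        LinearMap.mem_ker.mpr (funext fun i => sub_eq_zero.mpr (hτ i).2.symm)⟩
      refine ⟨(Polynomial.X ^ 0 : Polynomial B) ⊗ₜ x + (Polynomial.X : Polynomial B) • t, ?_⟩
      rw [map_add, map_add, hΦ, map_smul, hjX, ht, pow_zero, one_mul]
      exact hdiv
  have hbij : Function.Bijective Φ := ⟨hinj, fun m => by
    obtain ⟨t, ht⟩ := hsurj (j m) ((hrange _).mp ⟨m, rfl⟩)
    exact ⟨t, hj ht⟩⟩
  exact Module.Projective.of_equiv (LinearEquiv.ofBijective Φ hbij)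

section NormRing

variable (p : ℕ) [Fact p.Prime]

/-- The norm of `X 0` with respect to translations by multiples of `X 1`, in two variables. -/
def norm₂ : MvPolynomial (Fin 2) (ZMod p) := X 0 ^ p - X 1 ^ (p - 1) * X 0

lemma isFrobeniusHom_substVar_norm₂ : IsFrobeniusHom (substVar 0 (norm₂ p)).toRingHom := by
  have hp := (Fact.out : p.Prime).one_lt
  obtain ⟨i, hi⟩ := isolateVar_X_of_ne (F := ZMod p) (n := 1) (i := 0) (j := 1) (by decide)
  have h : isolateVar 0 (norm₂ p) = Polynomial.X ^ p +
      - (Polynomial.C (X i ^ (p - 1) : MvPolynomial (Fin 1) (ZMod p)) * Polynomial.X) := by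
    simp only [norm₂, map_sub, map_mul, map_pow, isolateVar_X_self, hi]
    ring
  have := Polynomial.monic_X_pow_add_and_natDegree_pos (n := p) (by omega)
    (q := - (Polynomial.C (X i ^ (p - 1) : MvPolynomial (Fin 1) (ZMod p)) * Polynomial.X)) (by
      refine lt_of_le_of_lt (b := 1) ?_ hp
      compute_degree)
  rw [← h] at this
  exact isFrobeniusHom_substVar _ _ this.1 this.2

lemma isolateVar_zero_X_succ {F : Type*} [Field F] {n : ℕ} (i : Fin n) :
    isolateVar (F := F) 0 (X i.succ) = Polynomial.C (X i) := by
  simp [isolateVar, finSuccEquiv_X_succ]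

lemma isolateVar_zero_X_one : isolateVar (F := ZMod p) (n := 2) 0 (X 1) = Polynomial.C (X 0) :=
  isolateVar_zero_X_succ 0

lemma isolateVar_zero_X_two : isolateVar (F := ZMod p) (n := 2) 0 (X 2) = Polynomial.C (X 1) :=
  isolateVar_zero_X_succ 1

lemma isolateVar_baseHom_C (b : MvPolynomial (Fin 2) (ZMod p)) :
    isolateVar 0 (baseHom p ((isolateVar 0).symm (Polynomial.C b))) =
      Polynomial.C (substVar 0 (norm₂ p) b) := by
  have h : ((isolateVar (F := ZMod p) (n := 2) 0).toAlgHom.comp ((baseHom p).comp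
      (isolateVar 0).symm.toAlgHom)).comp Polynomial.CAlgHom =
      Polynomial.CAlgHom.comp (substVar 0 (norm₂ p)) := by
    refine MvPolynomial.algHom_ext fun i => ?_
    fin_cases i
    · change isolateVar 0 (baseHom p ((isolateVar 0).symm (Polynomial.C (X 0)))) =
        Polynomial.C (substVar 0 (norm₂ p) (X 0))
      rw [← isolateVar_zero_X_one, AlgEquiv.symm_apply_apply, baseHom_X_one, substVar_X_self]
      simp only [normOne, norm₂, map_sub, map_mul, map_pow, isolateVar_zero_X_one,
        isolateVar_zero_X_two]
    · change isolateVar 0 (baseHom p ((isolateVar 0).symm (Polynomial.C (X 1)))) =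
        Polynomial.C (substVar 0 (norm₂ p) (X 1))
      rw [← isolateVar_zero_X_two, AlgEquiv.symm_apply_apply, baseHom_X_two,
        substVar_X_of_ne _ (by decide), isolateVar_zero_X_two]
  exact DFunLike.congr_fun h b

/-- The polynomial ring in two variables, regarded as a subring of itself via `norm₂`. -/
def NormRing : Type := MvPolynomial (Fin 2) (ZMod p)

instance : CommRing (NormRing p) := inferInstanceAs (CommRing (MvPolynomial (Fin 2) (ZMod p)))

instance : Algebra (NormRing p) (MvPolynomial (Fin 2) (ZMod p)) :=
  (substVar 0 (norm₂ p)).toRingHom.toAlgebra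

instance : Module.Projective (NormRing p) (MvPolynomial (Fin 2) (ZMod p)) :=
  IsFrobeniusHom.projective (isFrobeniusHom_substVar_norm₂ p)

/-- The polynomial ring over `NormRing p` as a subring of the ring in three variables. -/
def normRingHom : Polynomial (NormRing p) →+* MvPolynomial (Fin 3) (ZMod p) :=
  (((baseHom p).comp (isolateVar 0).symm.toAlgHom).toRingHom :
    Polynomial (MvPolynomial (Fin 2) (ZMod p)) →+* MvPolynomial (Fin 3) (ZMod p))

lemma isolateVar_normRingHom_C (b : NormRing p) :
    isolateVar 0 (normRingHom p (Polynomial.C b)) = Polynomial.C (algebraMap _ _ b) :=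
  isolateVar_baseHom_C p b

lemma normRingHom_X : normRingHom p Polynomial.X = dicksonTop p := by
  change baseHom p ((isolateVar 0).symm (Polynomial.X)) = _
  rw [← isolateVar_X_self, AlgEquiv.symm_apply_apply, baseHom_X_zero]

instance : Algebra (DicksonRing p) (Polynomial (NormRing p)) :=
  RingHom.toAlgebra (((isolateVar 0).toAlgHom.comp (towerHom p)).toRingHom :
    MvPolynomial (Fin 3) (ZMod p) →+* Polynomial (MvPolynomial (Fin 2) (ZMod p)))

lemma normRingHom_algebraMap (a : DicksonRing p) :
    normRingHom p (algebraMap _ _ a) = algebraMap _ _ a := by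
  change baseHom p ((isolateVar 0).symm (isolateVar 0 (towerHom p a))) = _
  rw [AlgEquiv.symm_apply_apply]; rfl

instance : Module.Projective (DicksonRing p) (Polynomial (NormRing p)) := by
  refine IsFrobeniusHom.projective ?_
  exact (IsFrobeniusHom.of_ringEquiv (isolateVar (F := ZMod p) (n := 2) 0).toRingEquiv).comp
    (isFrobeniusHom_towerHom p)

end NormRing

section Flag

variable {p : ℕ} [Fact p.Prime]

attribute [local instance] glAction

lemma smul_baseHom {h : GL (Fin 3) (ZMod p)}
    (hx : h • (X 2 : MvPolynomial (Fin 3) (ZMod p)) = X 2) {a : ZMod p}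
    (hy : h • (X 1 : MvPolynomial (Fin 3) (ZMod p)) = X 1 + a • X 2)
    (c : MvPolynomial (Fin 3) (ZMod p)) : h • baseHom p c = baseHom p c := by
  have hp : p ≠ 0 := (Fact.out : p.Prime).ne_zero
  have h0 : (polyAct (h⁻¹ : GL (Fin 3) (ZMod p)).1).comp (baseHom p) = baseHom p := by
    refine MvPolynomial.algHom_ext fun i => ?_
    change h • baseHom p (X i) = baseHom p (X i)
    fin_cases i
    · change h • baseHom p (X 0) = baseHom p (X 0)
      rw [baseHom_X_zero, ← dicksonHom_X_zero, gl_smul_dicksonHom]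
    · change h • baseHom p (X 1) = baseHom p (X 1)
      rw [baseHom_X_one, normOne, smul_sub, smul_mul', smul_pow', smul_pow', hx, hy, add_pow_char,
        smul_pow, ZMod.pow_card, mul_add, mul_smul_comm, pow_sub_one_mul hp]
      ring
    · change h • baseHom p (X 2) = baseHom p (X 2)
      rw [baseHom_X_two, hx]
  exact DFunLike.congr_fun h0 c

lemma natDegree_isolateVar_smul_le {h : GL (Fin 3) (ZMod p)}
    (hx : h • (X 2 : MvPolynomial (Fin 3) (ZMod p)) = X 2) {a : ZMod p}
    (hy : h • (X 1 : MvPolynomial (Fin 3) (ZMod p)) = X 1 + a • X 2)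
    (s : MvPolynomial (Fin 3) (ZMod p)) :
    (isolateVar 0 (h • s)).natDegree ≤ (isolateVar 0 s).natDegree := by
  let σ : MvPolynomial (Fin 2) (ZMod p) →ₐ[ZMod p] MvPolynomial (Fin 2) (ZMod p) :=
    aeval ![X 0 + a • X 1, X 1]
  let L := isolateVar 0 (h • (X 0 : MvPolynomial (Fin 3) (ZMod p)))
  have hL : L.natDegree ≤ 1 := by
    obtain ⟨w, hw⟩ : ∃ w, h • (X 0 : MvPolynomial (Fin 3) (ZMod p)) = linearForm w :=
      ⟨_, polyAct_X _ _⟩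
    simp only [L, hw, linearForm, Fin.sum_univ_three, map_add, map_smul, isolateVar_X_self,
      isolateVar_zero_X_one, isolateVar_zero_X_two]
    refine Polynomial.natDegree_add_le_of_degree_le
      (Polynomial.natDegree_add_le_of_degree_le ?_ ?_) ?_
    · exact (Polynomial.natDegree_smul_le _ _).trans Polynomial.natDegree_X_le
    · exact (Polynomial.natDegree_smul_le _ _).trans (by simp)
    · exact (Polynomial.natDegree_smul_le _ _).trans (by simp)
  have hs : (isolateVar 0 (h • s)) = ((isolateVar 0 s).map σ.toRingHom).comp L := by
    have hX (i : Fin 3) : isolateVar 0 (h • X i) =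
        ((isolateVar 0 (X i : MvPolynomial (Fin 3) (ZMod p))).map σ.toRingHom).comp L := by
      fin_cases i
      · simp only [Fin.zero_eta]
        rw [isolateVar_X_self, Polynomial.map_X, Polynomial.X_comp]
      · simp only [Fin.mk_one]
        rw [hy, map_add, map_smul, isolateVar_zero_X_one, isolateVar_zero_X_two,
          Polynomial.map_C, Polynomial.C_comp, Polynomial.smul_C, ← map_add]
        simp [σ]
      · simp only [Fin.reduceFinMk]
        rw [hx, isolateVar_zero_X_two, Polynomial.map_C, Polynomial.C_comp]
        simp [σ]
    induction s using MvPolynomial.induction_on with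
    | C c =>
      have hc : isolateVar 0 (C c : MvPolynomial (Fin 3) (ZMod p)) =
          Polynomial.C (C c : MvPolynomial (Fin 2) (ZMod p)) :=
        (isolateVar (F := ZMod p) (n := 2) 0).commutes c
      rw [gl_smul_C, hc, Polynomial.map_C, Polynomial.C_comp]
      simp
    | add s t hs ht =>
      rw [smul_add, map_add, hs, ht, map_add, Polynomial.map_add, Polynomial.add_comp]
    | mul_X s i hs =>
      rw [smul_mul', map_mul, hs, hX, map_mul, Polynomial.map_mul, Polynomial.mul_comp]
  rw [hs]
  refine Polynomial.natDegree_comp_le.trans ?_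
  calc _ ≤ (isolateVar 0 s).natDegree * 1 := Nat.mul_le_mul Polynomial.natDegree_map_le hL
    _ = _ := mul_one _

theorem projective_fixedPoints_of_flag (H : Subgroup (GL (Fin 3) (ZMod p)))
    (hx : ∀ h ∈ H, h • (X 2 : MvPolynomial (Fin 3) (ZMod p)) = X 2)
    (hy : ∀ h ∈ H, ∃ a : ZMod p, h • (X 1 : MvPolynomial (Fin 3) (ZMod p)) = X 1 + a • X 2) :
    Module.Projective (DicksonRing p)
      (FixedPoints.subalgebra (DicksonRing p) (MvPolynomial (Fin 3) (ZMod p)) H) := by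
  let R := FixedPoints.subalgebra (DicksonRing p) (MvPolynomial (Fin 3) (ZMod p)) H
  let φ := isolateVar (F := ZMod p) (n := 2) 0
  have hfix (h : H) (b : Polynomial (NormRing p)) : h • normRingHom p b = normRingHom p b := by
    obtain ⟨a, ha⟩ := hy h h.2
    exact smul_baseHom (hx h h.2) ha _
  let β : Polynomial (NormRing p) →+* R := (normRingHom p).codRestrict R fun b h => hfix h b
  let _ : Algebra (Polynomial (NormRing p)) R := β.toAlgebra
  have : IsScalarTower (DicksonRing p) (Polynomial (NormRing p)) R :=
    IsScalarTower.of_algebraMap_eq fun a => Subtype.ext (normRingHom_algebraMap p a).symm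
  have hN := isolateVar_dicksonTop p
  have hφC (b : NormRing p) (s : Polynomial (MvPolynomial (Fin 2) (ZMod p))) :
      b • s = φ (normRingHom p (Polynomial.C b)) * s := by
    rw [isolateVar_normRingHom_C, ← Polynomial.smul_eq_C_mul, algebraMap_smul]
  let τ (h : H) : Polynomial (MvPolynomial (Fin 2) (ZMod p)) →ₗ[NormRing p]
      Polynomial (MvPolynomial (Fin 2) (ZMod p)) :=
    { toFun := fun s => φ (h • φ.symm s)
      map_add' := fun s t => by rw [map_add, smul_add, map_add]
      map_smul' := fun b s => by
        rw [hφC, map_mul, AlgEquiv.symm_apply_apply, smul_mul', hfix, map_mul, ← hφC]; rfl }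
  have : Module.Projective (Polynomial (NormRing p)) R := by
    refine projective_polynomial_of_invariants (B := NormRing p)
      (hasProjectiveDimensionLE_mvPolynomial (ZMod p) 2) hN.1 hN.2 τ (fun h s => ?_)
      (fun h s hs => ?_) ((φ : _ →+* _).comp R.val.toRingHom).toAddMonoidHom ?_ (fun s => ?_)
      (fun b m => ?_) fun m => ?_
    · change φ (h • φ.symm _) = _ * φ (h • φ.symm s)
      have hd : h • dicksonTop p = dicksonTop p := by
        rw [← dicksonHom_X_zero]; exact gl_smul_dicksonHom p _ _
      rw [map_mul, AlgEquiv.symm_apply_apply, smul_mul', hd, map_mul]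
    · obtain ⟨a, ha⟩ := hy h h.2
      apply Polynomial.degree_lt_degree
      have h1 := natDegree_isolateVar_smul_le (hx h h.2) ha (φ.symm s)
      rw [AlgEquiv.apply_symm_apply] at h1
      refine lt_of_le_of_lt h1 ?_
      by_cases hs0 : s = 0
      · rw [hs0, Polynomial.natDegree_zero]; exact hN.2
      · exact Polynomial.natDegree_lt_natDegree hs0 hs
    · exact φ.injective.comp Subtype.val_injective
    · constructor
      · rintro ⟨m, rfl⟩ h
        change φ (h • φ.symm (φ (m : MvPolynomial (Fin 3) (ZMod p)))) = φ m
        rw [AlgEquiv.symm_apply_apply, m.2 h]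
      · intro hs
        refine ⟨⟨φ.symm s, fun h => φ.injective ?_⟩, φ.apply_symm_apply s⟩
        rw [AlgEquiv.apply_symm_apply]
        exact hs h
    · change φ (normRingHom p (Polynomial.C b) * m) = b • φ m
      rw [map_mul, ← hφC]
    · change φ (normRingHom p Polynomial.X * m) = φ (dicksonTop p) * φ m
      rw [map_mul, normRingHom_X]
  exact projective_restrictScalars (DicksonRing p) (Polynomial (NormRing p)) R

end Flag

section Flag

variable {p : ℕ} [Fact p.Prime]

lemma exists_fixed_vector {P V : Type*} [Group P] (hP : IsPGroup p P) [AddCommGroup V]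
    [Module (ZMod p) V] [Finite V] [Nontrivial V] (ρ : Representation (ZMod p) P V) :
    ∃ v, v ≠ 0 ∧ ∀ g, ρ g v = v := by
  let _ : MulAction P V := MulAction.compHom V ρ
  have hcard : p ∣ Nat.card V := by
    rw [Module.natCard_eq_pow_finrank (K := ZMod p), Nat.card_zmod]
    exact dvd_pow_self _ Module.finrank_pos.ne'
  obtain ⟨v, hv, h0⟩ := hP.exists_fixed_point_of_prime_dvd_card_of_fixed_point V hcard (a := 0)
    fun g => map_zero (ρ g)
  exact ⟨v, h0.symm, hv⟩

lemma exists_linearIndependent_finCons {F V : Type*} [Field F] [AddCommGroup V] [Module F V]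
    [FiniteDimensional F V] {n : ℕ} {v : Fin n → V} (hv : LinearIndependent F v)
    (hn : n < Module.finrank F V) : ∃ w, LinearIndependent F (Fin.cons w v : Fin (n + 1) → V) := by
  obtain ⟨w, hw⟩ : ∃ w, w ∉ Submodule.span F (Set.range v) := by
    by_contra! h
    have htop : Submodule.span F (Set.range v) = ⊤ := eq_top_iff.mpr fun w _ => h w
    have := finrank_range_le_card (R := F) v
    rw [Set.finrank, htop, finrank_top, Fintype.card_fin] at this
    omega
  exact ⟨w, linearIndependent_finCons.mpr ⟨hv, hw⟩⟩

attribute [local instance] glAction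

/-- The representation of the general linear group on coefficient vectors of linear forms. -/
def linearFormRep (n : ℕ) (F : Type*) [Field F] :
    Representation F (GL (Fin n) F) (Fin n → F) where
  toFun g := Matrix.vecMulLinear (g⁻¹ : GL (Fin n) F).1
  map_one' := by ext; simp
  map_mul' g h := by
    refine LinearMap.ext fun v => ?_
    simp [Matrix.vecMul_vecMul]

lemma gl_smul_linearForm_eq {n : ℕ} {F : Type*} [Field F] (g : GL (Fin n) F) (v : Fin n → F) :
    g • linearForm v = linearForm (linearFormRep n F g v) := gl_smul_linearForm g v

lemma exists_conj_flag {H : Subgroup (GL (Fin 3) (ZMod p))} (hH : IsPGroup p H) :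
    ∃ γ : GL (Fin 3) (ZMod p), ∀ h ∈ H,
      (γ⁻¹ * h * γ) • (X 2 : MvPolynomial (Fin 3) (ZMod p)) = X 2 ∧
      ∃ a : ZMod p, (γ⁻¹ * h * γ) • (X 1 : MvPolynomial (Fin 3) (ZMod p)) = X 1 + a • X 2 := by
  let ρ : Representation (ZMod p) H (Fin 3 → ZMod p) := (linearFormRep 3 (ZMod p)).comp H.subtype
  obtain ⟨v, hv0, hv⟩ := exists_fixed_vector hH ρ
  let W := Submodule.span (ZMod p) {v}
  have hW (h : H) : W ≤ W.comap (ρ h) := by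
    rw [Submodule.span_le, Set.singleton_subset_iff]
    change ρ h v ∈ W
    rw [hv]
    exact Submodule.mem_span_singleton_self v
  have : Nontrivial ((Fin 3 → ZMod p) ⧸ W) := by
    rw [Submodule.Quotient.nontrivial_iff]
    intro h
    have := finrank_span_singleton (K := ZMod p) hv0
    rw [show Submodule.span (ZMod p) {v} = ⊤ from h, finrank_top, Module.finrank_fin_fun] at this
    omega
  have : Finite ((Fin 3 → ZMod p) ⧸ W) := Finite.of_surjective _ W.mkQ_surjective
  obtain ⟨w', hw0, hw⟩ := exists_fixed_vector hH (ρ.quotient W hW)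
  obtain ⟨w, rfl⟩ := W.mkQ_surjective w'
  have hw1 (h : H) : ∃ a : ZMod p, ρ h w = w + a • v := by
    have h1 : W.mkQ (ρ h w - w) = 0 := by rw [map_sub, sub_eq_zero]; exact hw h
    rw [Submodule.mkQ_apply, Submodule.Quotient.mk_eq_zero, Submodule.mem_span_singleton] at h1
    obtain ⟨a, ha⟩ := h1
    exact ⟨a, by rw [ha]; abel⟩
  have hli : LinearIndependent (ZMod p) (Fin.cons w ![v] : Fin 2 → Fin 3 → ZMod p) := by
    rw [linearIndependent_finCons]
    refine ⟨linearIndependent_unique_iff.mpr (by simpa using hv0), fun h => hw0 ?_⟩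
    rw [Submodule.mkQ_apply, Submodule.Quotient.mk_eq_zero]
    simpa using h
  obtain ⟨u, hu⟩ := exists_linearIndependent_finCons hli (by simp)
  obtain ⟨γ, hγ⟩ := Matrix.linearIndependent_rows_iff_isUnit.mp hu
  have hrow (i : Fin 3) : γ⁻¹ • (X i : MvPolynomial (Fin 3) (ZMod p)) = linearForm (γ.1 i) := by
    rw [gl_smul_def, polyAct_X, inv_inv]
  have hv2 : γ⁻¹ • (X 2 : MvPolynomial (Fin 3) (ZMod p)) = linearForm v := by rw [hrow, hγ]; rfl
  have hw2 : γ⁻¹ • (X 1 : MvPolynomial (Fin 3) (ZMod p)) = linearForm w := by rw [hrow, hγ]; rfl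
  have hv3 : γ • linearForm v = X 2 := by rw [← hv2, smul_inv_smul]
  have hw3 : γ • linearForm w = X 1 := by rw [← hw2, smul_inv_smul]
  refine ⟨γ⁻¹, fun h hh => ⟨?_, ?_⟩⟩
  · rw [inv_inv, mul_smul, mul_smul, hv2, gl_smul_linearForm_eq]
    exact (congrArg (fun x => γ • linearForm x) (hv ⟨h, hh⟩)).trans hv3
  · obtain ⟨a, ha⟩ := hw1 ⟨h, hh⟩
    refine ⟨a, ?_⟩
    rw [inv_inv, mul_smul, mul_smul, hw2, gl_smul_linearForm_eq]
    refine (congrArg (fun x => γ • linearForm x) ha).trans ?_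
    rw [linearForm_add, linearForm_smul, smul_add, hw3, gl_smul_smul, hv3]

end Flag

section Transfer

variable {A S G : Type*} [CommRing A] [CommRing S] [Algebra A S] [Group G]
  [MulSemiringAction G S] [SMulCommClass G A S]

lemma projective_fixedPoints_of_subgroup (Q : Subgroup G) [Finite G]
    (hQ : IsUnit (Q.index : A)) [Module.Projective A (FixedPoints.subalgebra A S Q)] :
    Module.Projective A (FixedPoints.subalgebra A S G) := by
  classical
  obtain ⟨c, hc⟩ := hQ.exists_left_inv
  let _ := Fintype.ofFinite (G ⧸ Q)
  have hout (s : FixedPoints.subalgebra A S Q) (g : G) :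
      ((g : G ⧸ Q).out : G) • (s : S) = g • (s : S) := by
    obtain ⟨q, hq⟩ := QuotientGroup.mk_out_eq_mul Q g
    rw [hq, mul_smul]
    exact congrArg _ (s.2 q)
  have hinv (s : FixedPoints.subalgebra A S Q) (g : G) :
      g • ∑ q : G ⧸ Q, (q.out : G) • (s : S) = ∑ q : G ⧸ Q, (q.out : G) • (s : S) := by
    rw [Finset.smul_sum]
    refine Eq.trans ?_ (Equiv.sum_comp (MulAction.toPerm g : Equiv.Perm (G ⧸ Q))
      fun q : G ⧸ Q => (q.out : G) • (s : S))
    refine Finset.sum_congr rfl fun q _ => ?_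
    have h : g • q = ((g * q.out : G) : G ⧸ Q) := by
      conv_lhs => rw [← QuotientGroup.out_eq' q]
      rfl
    rw [MulAction.toPerm_apply, h, hout, mul_smul]
  let π : FixedPoints.subalgebra A S Q →ₗ[A] FixedPoints.subalgebra A S G :=
    { toFun := fun s => ⟨c • ∑ q : G ⧸ Q, (q.out : G) • (s : S), fun g => by
        rw [smul_comm, hinv]⟩
      map_add' := fun s t => Subtype.ext (by simp [Finset.sum_add_distrib])
      map_smul' := fun a s => Subtype.ext (by
        change c • ∑ q : G ⧸ Q, (q.out : G) • (a • (s : S)) =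
          a • c • ∑ q : G ⧸ Q, (q.out : G) • (s : S)
        simp only [smul_comm _ a, ← Finset.smul_sum]) }
  let i : FixedPoints.subalgebra A S G →ₗ[A] FixedPoints.subalgebra A S Q :=
    { toFun := fun s => ⟨s, fun q => s.2 q⟩
      map_add' := fun _ _ => rfl
      map_smul' := fun _ _ => rfl }
  refine Module.Projective.of_split i π (LinearMap.ext fun s => Subtype.ext ?_)
  change c • ∑ q : G ⧸ Q, (q.out : G) • (s : S) = s
  have hs (g : G) : g • (s : S) = s := s.2 g
  simp only [hs]
  rw [Finset.sum_const, Finset.card_univ, ← Nat.card_eq_fintype_card, ← Subgroup.index,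
    ← Nat.cast_smul_eq_nsmul A, smul_smul, hc, one_smul]

lemma projective_fixedPoints_of_conj (H K : Subgroup G) (γ : G)
    (hHK : ∀ h, h ∈ H ↔ γ⁻¹ * h * γ ∈ K) [Module.Projective A (FixedPoints.subalgebra A S K)] :
    Module.Projective A (FixedPoints.subalgebra A S H) := by
  let e : FixedPoints.subalgebra A S K ≃ₗ[A] FixedPoints.subalgebra A S H :=
    { toFun := fun s => ⟨γ • (s : S), fun h => by
        have := s.2 ⟨_, (hHK h).mp h.2⟩
        change (γ⁻¹ * h * γ) • (s : S) = s at this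
        rw [mul_smul, mul_smul, inv_smul_eq_iff] at this
        exact this⟩
      invFun := fun s => ⟨γ⁻¹ • (s : S), fun k => by
        have hk : γ * k * γ⁻¹ ∈ H := (hHK _).mpr (by
          rw [show γ⁻¹ * (γ * k * γ⁻¹) * γ = (k : G) by group]; exact k.2)
        have := s.2 ⟨_, hk⟩
        change (γ * k * γ⁻¹) • (s : S) = s at this
        rw [mul_smul, mul_smul, ← eq_inv_smul_iff] at this
        exact this⟩
      left_inv := fun s => Subtype.ext (inv_smul_smul γ (s : S))
      right_inv := fun s => Subtype.ext (smul_inv_smul γ (s : S))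
      map_add' := fun s t => Subtype.ext (smul_add γ (s : S) t)
      map_smul' := fun a s => Subtype.ext (smul_comm γ a (s : S)) }
  exact Module.Projective.of_equiv e

end Transfer

section Projectivity

variable {p : ℕ} [Fact p.Prime]

attribute [local instance] glAction

theorem projective_fixedPoints (Γ : Subgroup (GL (Fin 3) (ZMod p))) :
    Module.Projective (DicksonRing p)
      (FixedPoints.subalgebra (DicksonRing p) (MvPolynomial (Fin 3) (ZMod p)) Γ) := by
  obtain ⟨P⟩ : Nonempty (Sylow p Γ) := inferInstance
  let H : Subgroup (GL (Fin 3) (ZMod p)) := P.1.map Γ.subtype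
  have hH : IsPGroup p H := P.2.map _
  obtain ⟨γ, hγ⟩ := exists_conj_flag hH
  let K : Subgroup (GL (Fin 3) (ZMod p)) := H.map (MulAut.conj γ⁻¹).toMonoidHom
  have hK {k : GL (Fin 3) (ZMod p)} (hk : k ∈ K) : ∃ h ∈ H, γ⁻¹ * h * γ = k := by
    obtain ⟨h, hh, rfl⟩ := hk
    exact ⟨h, hh, by simp⟩
  have := projective_fixedPoints_of_flag K
    (fun k hk => by obtain ⟨h, hh, rfl⟩ := hK hk; exact (hγ h hh).1)
    (fun k hk => by obtain ⟨h, hh, rfl⟩ := hK hk; exact (hγ h hh).2)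
  have := projective_fixedPoints_of_conj (A := DicksonRing p)
    (S := MvPolynomial (Fin 3) (ZMod p)) H K γ fun h => by
      constructor
      · exact fun hh => ⟨h, hh, by simp⟩
      · intro hh
        obtain ⟨h', hh', he⟩ := hK hh
        rw [mul_left_inj, mul_right_inj] at he
        exact he ▸ hh'
  let e : FixedPoints.subalgebra (DicksonRing p) (MvPolynomial (Fin 3) (ZMod p)) H ≃ₗ[DicksonRing p]
      FixedPoints.subalgebra (DicksonRing p) (MvPolynomial (Fin 3) (ZMod p)) P.1 :=
    { toFun := fun s => ⟨s, fun h => s.2 ⟨h.1.1, h.1, h.2, rfl⟩⟩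
      invFun := fun s => ⟨s, by rintro ⟨_, h, hh, rfl⟩; exact s.2 ⟨h, hh⟩⟩
      left_inv := fun _ => rfl
      right_inv := fun _ => rfl
      map_add' := fun _ _ => rfl
      map_smul' := fun _ _ => rfl }
  have := Module.Projective.of_equiv e
  refine projective_fixedPoints_of_subgroup P.1 ?_
  have h0 : ((P.1.index : ℕ) : ZMod p) ≠ 0 := by
    rw [Ne, ZMod.natCast_eq_zero_iff]
    exact P.not_dvd_index
  have := h0.isUnit.map (C : ZMod p →+* MvPolynomial (Fin 3) (ZMod p))
  rw [map_natCast] at this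
  exact this

end Projectivity

section Gorenstein

lemma hasInjectiveDimensionLE_of_ringEquiv {R R' : Type u} [CommRing R] [CommRing R'] (e : R ≃+* R')
    (n : ℕ) [h : HasInjectiveDimensionLE (ModuleCat.of R R) n] :
    HasInjectiveDimensionLE (ModuleCat.of R' R') n := by
  let _ := RingHomInvPair.of_ringEquiv e
  let _ := RingHomInvPair.of_ringEquiv e.symm
  let e' : ModuleCat.of R R ≃ₛₗ[RingHomClass.toRingHom e] ModuleCat.of R' R' :=
    { e with map_smul' := fun r x => _root_.map_mul e r x }
  exact (ModuleCat.hasInjectiveDimensionLE_iff_of_semiLinearEquiv e e' n).mp h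

lemma isGorensteinRing_of_hasInjectiveDimensionLE (R : Type u) [CommRing R] [IsNoetherianRing R]
    (n : ℕ) [HasInjectiveDimensionLE (ModuleCat.of R R) n] : IsGorensteinRing R := by
  refine ⟨‹_›, fun P _ => ?_⟩
  let M : ModuleCat.{u} R := ModuleCat.of R R
  have := ModuleCat.localizedModule_isLocalizedModule M P.primeCompl
  have h := M.localizedModule_hasInjectiveDimensionLE n P.primeCompl
  let e := (IsLocalizedModule.linearEquiv P.primeCompl (M.localizedModuleMkLinearMap P.primeCompl)
    (Algebra.linearMap R (Localization P.primeCompl))).extendScalarsOfIsLocalization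
      P.primeCompl (Localization P.primeCompl)
  have := (ModuleCat.hasInjectiveDimensionLE_iff_of_linearEquiv
    (N := ModuleCat.of (Localization P.primeCompl) (Localization P.primeCompl)) e n).mp h
  exact HasFiniteInjectiveDimension.of_hasInjectiveDimensionLE n _

end Gorenstein

section Main

variable {p : ℕ} [Fact p.Prime]

attribute [local instance] glAction

instance : Module.Finite (DicksonRing p) (MvPolynomial (Fin 3) (ZMod p)) :=
  isFrobeniusHom_algebraMap_dicksonRing.finite

instance (M : ModuleCat.{0} (DicksonRing p)) : HasInjectiveDimensionLE M 3 :=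
  hasInjectiveDimensionLE_of_forall_hasProjectiveDimensionLE 3
    (hasProjectiveDimensionLE_mvPolynomial (ZMod p) 3) M

instance (Γ : Subgroup (GL (Fin 3) (ZMod p))) : IsNoetherianRing
    (FixedPoints.subalgebra (DicksonRing p) (MvPolynomial (Fin 3) (ZMod p)) Γ) :=
  have : IsNoetherian (DicksonRing p)
    (FixedPoints.subalgebra (DicksonRing p) (MvPolynomial (Fin 3) (ZMod p)) Γ) :=
      isNoetherian_submodule' (Subalgebra.toSubmodule
        (FixedPoints.subalgebra (DicksonRing p) (MvPolynomial (Fin 3) (ZMod p)) Γ))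
  isNoetherian_of_tower (DicksonRing p) this

lemma hasInjectiveDimensionLE_fixedPoints_specialLinearGroup
    (G : Subgroup (Matrix.SpecialLinearGroup (Fin 3) (ZMod p))) :
    HasInjectiveDimensionLE (ModuleCat.of
      (FixedPoints.subalgebra (DicksonRing p) (MvPolynomial (Fin 3) (ZMod p))
        (G.map Matrix.SpecialLinearGroup.toGL))
      (FixedPoints.subalgebra (DicksonRing p) (MvPolynomial (Fin 3) (ZMod p))
        (G.map Matrix.SpecialLinearGroup.toGL))) 3 := by
  let Γ := G.map Matrix.SpecialLinearGroup.toGL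
  let _ : Fintype Γ := Fintype.ofFinite Γ
  have hdet : ∀ g ∈ Γ, g.1.det = 1 := by
    rintro _ ⟨g, -, rfl⟩
    exact g.2
  have : FaithfulSMul (DicksonRing p) (MvPolynomial (Fin 3) (ZMod p)) :=
    (faithfulSMul_iff_algebraMap_injective _ _).mpr
      isFrobeniusHom_algebraMap_dicksonRing.injective
  have := projective_fixedPoints Γ
  obtain ⟨Λ, hΛG, hΛ, hΛ₀⟩ := exists_invariant_dual (p := p)
  have hX : (1 : Fin 3 → ZMod p) ≠ 0 := one_ne_zero
  refine hasInjectiveDimensionLE_fixedPoints 3 Λ ?_ hΛ hΛ₀ (differentElement Γ)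
    (differentElement_ne_zero Γ) (smul_differentElement Γ)
    (differentElement_dvd_sum_smul hdet) (fun f hf => exists_not_mul_differentElement_dvd hdet hf)
    ((exists_not_mul_differentElement_dvd hdet (prime_linearForm hX)).imp
      fun s hs h => hs (h ▸ dvd_zero _))
  rintro ⟨_, g, -, rfl⟩ s
  exact hΛG g s

/-- The invariant ring as a ring of fixed points. -/
def fixedPointsEquivInvariantRing (G : Subgroup (Matrix.SpecialLinearGroup (Fin 3) (ZMod p))) :
    FixedPoints.subalgebra (DicksonRing p) (MvPolynomial (Fin 3) (ZMod p))
      (G.map Matrix.SpecialLinearGroup.toGL) ≃+* invariantRing G where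
  toFun s := ⟨s, by
    rintro _ ⟨g, hg, rfl⟩
    have := s.2 ⟨_, g⁻¹, G.inv_mem hg, rfl⟩
    change Matrix.SpecialLinearGroup.toGL g⁻¹ • (s : MvPolynomial (Fin 3) (ZMod p)) = s at this
    rwa [gl_smul_def, ← map_inv, inv_inv] at this⟩
  invFun s := ⟨s, by
    rintro ⟨_, g, hg, rfl⟩
    change Matrix.SpecialLinearGroup.toGL g • (s : MvPolynomial (Fin 3) (ZMod p)) = s
    rw [gl_smul_def, ← map_inv]
    exact s.2 _ ⟨g⁻¹, G.inv_mem hg, rfl⟩⟩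
  left_inv _ := rfl
  right_inv _ := rfl
  map_mul' _ _ := rfl
  map_add' _ _ := rfl

theorem isGorensteinRing_invariantRing
    (G : Subgroup (Matrix.SpecialLinearGroup (Fin 3) (ZMod p))) :
    IsGorensteinRing (invariantRing G) := by
  let e := fixedPointsEquivInvariantRing G
  have := hasInjectiveDimensionLE_fixedPoints_specialLinearGroup G
  have := hasInjectiveDimensionLE_of_ringEquiv e 3
  have := isNoetherianRing_of_ringEquiv _ e
  exact isGorensteinRing_of_hasInjectiveDimensionLE _ 3

end Main

/-- If `G ⊆ SL(3, 𝔽_p)` is a finite group and `V = 𝔽_p³` is a reducible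
`G`-module, then `S(V)^G` is Gorenstein. -/
theorem stmt0 (p : ℕ) [Fact p.Prime]
    (G : Subgroup (Matrix.SpecialLinearGroup (Fin 3) (ZMod p)))
    (hred : ∃ U : Submodule (ZMod p) (Fin 3 → ZMod p), U ≠ ⊥ ∧ U ≠ ⊤ ∧
      ∀ g ∈ G, ∀ x ∈ U, x ᵥ* (g : Matrix (Fin 3) (Fin 3) (ZMod p)) ∈ U) :
    IsGorensteinRing ↥(invariantRing G) := by
  exact isGorensteinRing_invariantRing G

end
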